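/- arXiv:2604.23751 — 5 statements merged into one kernel-verified Lean document; each statement's English description precedes it below -/
import Mathlib

section
/- The map μ ↦ φ_μ sending a 231-avoiding permuton to the excursion associated with its RLM curve is a homeomorphism from the set of 231-avoiding permutons (with the topology of weak convergence of measures) onto E (with the supremum norm); in particular it is a bijection and both it and its inverse are continuous. -/
open MeasureTheory Filter Set

noncomputable section

/-- A permuton: a Borel probability measure on the plane (supported on `[0,1]²`) whose
two marginals are the Lebesgue measure on `[0,1]`. -/
def IsPermuton (μ : Measure (ℝ × ℝ)) : Prop :=
  IsProbabilityMeasure μ ∧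
    μ.map Prod.fst = volume.restrict (Set.Icc (0:ℝ) 1) ∧
    μ.map Prod.snd = volume.restrict (Set.Icc (0:ℝ) 1)

/-- A permuton avoids the pattern `231` if `μ⊗μ⊗μ` gives zero mass to triples of
points in relative position `231`. -/
def PermutonAvoids231 (μ : Measure (ℝ × ℝ)) : Prop :=
  (μ.prod (μ.prod μ))
    {t : (ℝ × ℝ) × (ℝ × ℝ) × (ℝ × ℝ) |
      t.1.1 < t.2.1.1 ∧ t.2.1.1 < t.2.2.1 ∧ t.2.2.2 < t.1.2 ∧ t.1.2 < t.2.1.2} = 0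

/-- The RLM curve of a permuton: `f_μ(x) = max{y ∈ [0,1] : μ([x,1]×[0,y]) = 0}`. -/
def RLMcurve (μ : Measure (ℝ × ℝ)) (x : ℝ) : ℝ :=
  sSup {y : ℝ | y ∈ Set.Icc (0:ℝ) 1 ∧ μ (Set.Icc x 1 ×ˢ Set.Icc 0 y) = 0}

/-- The completed graph `G_f = {(x,y) : x ∈ [0,1], f(x⁻) ≤ y ≤ f(x)}` of `f`. -/
def completedGraph (f : ℝ → ℝ) : Set (ℝ × ℝ) :=
  {p : ℝ × ℝ | p.1 ∈ Set.Icc (0:ℝ) 1 ∧ p.2 ∈ Set.Icc (Function.leftLim f p.1) (f p.1)}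

/-- The rotated-flipped-rescaled graph `{(t + φ(t), t − φ(t)) : t ∈ [0,1]}` of an
excursion `φ`. -/
def excursionGraph (φ : ℝ → ℝ) : Set (ℝ × ℝ) :=
  {q : ℝ × ℝ | ∃ t ∈ Set.Icc (0:ℝ) 1, q = (t + φ t, t - φ t)}

/-- An excursion: a nonnegative `1`-Lipschitz function with `φ(0) = φ(1) = 0`
(defined on `[0,1]` and extended by `0` to `ℝ`). -/
def IsExcursion (φ : BoundedContinuousFunction ℝ ℝ) : Prop :=
  LipschitzWith 1 ⇑φ ∧ (∀ t : ℝ, 0 ≤ φ t) ∧ φ 0 = 0 ∧ φ 1 = 0 ∧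
    ∀ t : ℝ, t ∉ Set.Icc (0:ℝ) 1 → φ t = 0

/-- The space `E` of excursions, equipped with the supremum norm topology. -/
def Espace : Type := {φ : BoundedContinuousFunction ℝ ℝ // IsExcursion φ}

instance : TopologicalSpace Espace := by unfold Espace; infer_instance

/-- The space of `231`-avoiding permutons, with the topology of weak convergence. -/
def Permutons231 : Type :=
  {μ : ProbabilityMeasure (ℝ × ℝ) //
    IsPermuton (μ : Measure (ℝ × ℝ)) ∧ PermutonAvoids231 (μ : Measure (ℝ × ℝ))}

instance : TopologicalSpace Permutons231 := by unfold Permutons231; infer_instance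

open scoped Topology NNReal ENNReal

/-! ### The upper-left mass associated with an excursion -/

namespace IsExcursion

variable {φ : BoundedContinuousFunction ℝ ℝ}

lemma abs_sub_le (h : IsExcursion φ) (s t : ℝ) : |φ s - φ t| ≤ |s - t| := by
  simpa [Real.dist_eq] using h.1.dist_le_mul s t

lemma monotone_add (h : IsExcursion φ) : Monotone fun t ↦ t + φ t := fun s t hst ↦ by
  have := (abs_le.1 (h.abs_sub_le s t)).2
  rw [abs_sub_comm, abs_of_nonneg (sub_nonneg.2 hst)] at this
  dsimp only; linarith

lemma monotone_sub (h : IsExcursion φ) : Monotone fun t ↦ t - φ t := fun s t hst ↦ by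
  have := (abs_le.1 (h.abs_sub_le s t)).1
  rw [abs_sub_comm s t, abs_of_nonneg (sub_nonneg.2 hst)] at this
  dsimp only; linarith

end IsExcursion

/-- An upper bound, computed at the point `(r + φ r, r - φ r)` of the excursion graph, for the
mass that the permuton associated with `φ` gives to `(-∞, a] × [b, ∞)`. -/
def ulCost (φ : ℝ → ℝ) (a b r : ℝ) : ℝ :=
  max (a - (r + φ r)) 0 + 2 * φ r + max (r - φ r - b) 0

/-- The mass that the permuton associated with `φ` gives to `(-∞, a] × [b, ∞)`, for
`a, b ∈ [0, 1]`. -/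
def ulMass (φ : ℝ → ℝ) (a b : ℝ) : ℝ :=
  sInf (ulCost φ a b '' Icc 0 1)

namespace IsExcursion

variable {φ ψ : BoundedContinuousFunction ℝ ℝ} {a b r : ℝ}

lemma ulCost_nonneg (h : IsExcursion φ) (a b r : ℝ) : 0 ≤ ulCost φ a b r := by
  have := h.2.1 r
  unfold ulCost; positivity

lemma sub_le_ulCost (φ : ℝ → ℝ) (a b r : ℝ) : a - b ≤ ulCost φ a b r := by
  unfold ulCost
  linarith [le_max_left (a - (r + φ r)) 0, le_max_left (r - φ r - b) 0]

lemma ulMass_le (h : IsExcursion φ) (a b : ℝ) (hr : r ∈ Icc (0 : ℝ) 1) :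
    ulMass φ a b ≤ ulCost φ a b r :=
  csInf_le ⟨0, by rintro _ ⟨s, -, rfl⟩; exact h.ulCost_nonneg a b s⟩ (mem_image_of_mem _ hr)

lemma exists_ulMass_eq (φ : BoundedContinuousFunction ℝ ℝ) (a b : ℝ) :
    ∃ r ∈ Icc (0 : ℝ) 1, ulMass φ a b = ulCost φ a b r := by
  have hc : Continuous (ulCost φ a b) := by
    unfold ulCost
    have := φ.continuous
    fun_prop
  obtain ⟨r, hr, he⟩ :=
    isCompact_Icc.exists_sInf_image_eq (nonempty_Icc.2 zero_le_one) hc.continuousOn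
  exact ⟨r, hr, he⟩

lemma ulMass_nonneg (h : IsExcursion φ) (a b : ℝ) : 0 ≤ ulMass φ a b := by
  obtain ⟨r, -, hr⟩ := exists_ulMass_eq φ a b
  exact hr ▸ h.ulCost_nonneg a b r

lemma sub_le_ulMass (φ : BoundedContinuousFunction ℝ ℝ) (a b : ℝ) : a - b ≤ ulMass φ a b := by
  obtain ⟨r, -, hr⟩ := exists_ulMass_eq φ a b
  exact hr ▸ sub_le_ulCost φ a b r

lemma ulMass_one_right (h : IsExcursion φ) (ha : a ≤ 1) : ulMass φ a 1 = 0 := by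
  refine le_antisymm ?_ (h.ulMass_nonneg _ _)
  refine (h.ulMass_le a 1 (right_mem_Icc.2 zero_le_one)).trans_eq ?_
  simp [ulCost, h.2.2.2.1, ha]

lemma ulMass_zero_left (h : IsExcursion φ) (hb : 0 ≤ b) : ulMass φ 0 b = 0 := by
  refine le_antisymm ?_ (h.ulMass_nonneg _ _)
  refine (h.ulMass_le 0 b (left_mem_Icc.2 zero_le_one)).trans_eq ?_
  simp [ulCost, h.2.2.1, hb]

lemma ulMass_zero_right (h : IsExcursion φ) (ha : 0 ≤ a) : ulMass φ a 0 = a := by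
  refine le_antisymm ?_ (by simpa using sub_le_ulMass φ a 0)
  refine (h.ulMass_le a 0 (left_mem_Icc.2 zero_le_one)).trans_eq ?_
  simp [ulCost, h.2.2.1, ha]

lemma ulMass_one_left (h : IsExcursion φ) (hb : b ≤ 1) : ulMass φ 1 b = 1 - b := by
  refine le_antisymm ?_ (sub_le_ulMass φ 1 b)
  refine (h.ulMass_le 1 b (right_mem_Icc.2 zero_le_one)).trans_eq ?_
  simp [ulCost, h.2.2.2.1, hb]

lemma ulMass_le_add_left (h : IsExcursion φ) {a₁ a₂ : ℝ} (b : ℝ) :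
    ulMass φ a₂ b ≤ ulMass φ a₁ b + max (a₂ - a₁) 0 := by
  obtain ⟨r, hr, he⟩ := exists_ulMass_eq φ a₁ b
  refine (h.ulMass_le a₂ b hr).trans ?_
  rw [he]; unfold ulCost
  grind

lemma ulMass_le_add_right (h : IsExcursion φ) (a : ℝ) {b₁ b₂ : ℝ} :
    ulMass φ a b₁ ≤ ulMass φ a b₂ + max (b₂ - b₁) 0 := by
  obtain ⟨r, hr, he⟩ := exists_ulMass_eq φ a b₂
  refine (h.ulMass_le a b₁ hr).trans ?_
  rw [he]; unfold ulCost
  grind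

lemma ulMass_add_ulMass_le (h : IsExcursion φ) {a₁ a₂ b₁ b₂ : ℝ} (ha : a₁ ≤ a₂) (hb : b₁ ≤ b₂) :
    ulMass φ a₂ b₂ + ulMass φ a₁ b₁ ≤ ulMass φ a₂ b₁ + ulMass φ a₁ b₂ := by
  obtain ⟨r, hr, he⟩ := exists_ulMass_eq φ a₂ b₁
  obtain ⟨s, hs, he'⟩ := exists_ulMass_eq φ a₁ b₂
  rw [he, he']
  rcases le_total r s with hrs | hrs
  · have h₁ := h.ulMass_le a₁ b₁ hr
    have h₂ := h.ulMass_le a₂ b₂ hs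
    have h₃ : r + φ r ≤ s + φ s := h.monotone_add hrs
    unfold ulCost at *
    grind
  · have h₁ := h.ulMass_le a₁ b₁ hs
    have h₂ := h.ulMass_le a₂ b₂ hr
    have h₃ : s - φ s ≤ r - φ r := h.monotone_sub hrs
    unfold ulCost at *
    grind

lemma ulMass_le_add_dist (h : IsExcursion φ) (a b : ℝ) :
    ulMass φ a b ≤ ulMass ψ a b + 4 * dist φ ψ := by
  obtain ⟨r, hr, he⟩ := exists_ulMass_eq ψ a b
  have hd := abs_le.1 ((Real.dist_eq _ _).symm.trans_le (φ.dist_coe_le_dist (g := ψ) r))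
  refine (h.ulMass_le a b hr).trans ?_
  rw [he]; unfold ulCost
  grind

/-- No triple of boxes in relative position `231` all carry mass. -/
lemma ulMass_not_231 (h : IsExcursion φ) {a₁ a₂ b₁ b₂ : ℝ}
    (hA : ulMass φ a₁ b₂ < ulMass φ a₁ b₁) (hB : ulMass φ a₁ b₂ < ulMass φ a₂ b₂)
    (hC : a₂ - b₁ < ulMass φ a₂ b₁) : False := by
  obtain ⟨r, hr, he⟩ := exists_ulMass_eq φ a₁ b₂
  have h₁ := h.ulMass_le a₁ b₁ hr
  have h₂ := h.ulMass_le a₂ b₂ hr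
  have h₃ := h.ulMass_le a₂ b₁ hr
  unfold ulCost at *
  grind

lemma ulMass_graph_le (h : IsExcursion φ) (hr : r ∈ Icc (0 : ℝ) 1) :
    ulMass φ (r + φ r) (r - φ r) ≤ 2 * φ r := by
  refine (h.ulMass_le _ _ hr).trans_eq ?_
  simp [ulCost]

lemma lt_ulMass (h : IsExcursion φ) {t u : ℝ} (hu : u < φ t) :
    2 * u < ulMass φ (t + u) (t - u) := by
  obtain ⟨r, hr, he⟩ := exists_ulMass_eq φ (t + u) (t - u)
  rw [he]
  rcases le_total r t with hrt | hrt
  · have h₃ : r - φ r ≤ t - φ t := h.monotone_sub hrt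
    unfold ulCost
    grind
  · have h₃ : t + φ t ≤ r + φ r := h.monotone_add hrt
    unfold ulCost
    grind

end IsExcursion

/-! ### Planar measures with a prescribed distribution function -/

lemma sum_range_ite_telescope (g : ℕ → ℝ) (h₀ : g 0 = 0) (m M : ℕ) :
    ∑ i ∈ Finset.range M, (if i + 1 ≤ m then g (i + 1) - g i else 0) = g (min M m) := by
  induction M with
  | zero => simp [h₀]
  | succ M ih =>
    rw [Finset.sum_range_succ, ih]
    split_ifs with h
    · rw [min_eq_left h, min_eq_left (by omega)]; ring
    · rw [min_eq_right (by omega), min_eq_right (by omega), add_zero]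

/-- A distribution function on the unit square, extended to the plane, that is `1`-Lipschitz in each
variable. -/
structure IsLipschitzCDF (K : ℝ → ℝ → ℝ) : Prop where
  rect_nonneg : ∀ ⦃a₁ a₂ b₁ b₂ : ℝ⦄, a₁ ≤ a₂ → b₁ ≤ b₂ →
    0 ≤ K a₂ b₂ - K a₁ b₂ - (K a₂ b₁ - K a₁ b₁)
  abs_sub_left_le : ∀ a a' b, |K a b - K a' b| ≤ |a - a'|
  abs_sub_right_le : ∀ a b b', |K a b - K a b'| ≤ |b - b'|
  eq_zero_left : ∀ a ≤ 0, ∀ b, K a b = 0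
  eq_zero_right : ∀ a, ∀ b ≤ 0, K a b = 0
  eq_one_left : ∀ a ≥ 1, ∀ b, K a b = K 1 b
  eq_one_right : ∀ a, ∀ b ≥ 1, K a b = K a 1
  one_one : K 1 1 = 1

namespace IsLipschitzCDF

variable {K : ℝ → ℝ → ℝ}

lemma continuous_right (hK : IsLipschitzCDF K) (a : ℝ) : Continuous (K a) :=
  (LipschitzWith.of_dist_le_mul (K := 1) fun x y ↦ by
    simpa [Real.dist_eq] using hK.abs_sub_right_le a x y).continuous

/-- The mass of the strip `a₁ < x ≤ a₂`, as a function of the height. -/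
def strip (hK : IsLipschitzCDF K) {a₁ a₂ : ℝ} (h : a₁ ≤ a₂) : StieltjesFunction ℝ where
  toFun b := K a₂ b - K a₁ b
  mono' b₁ b₂ hb := by linarith [hK.rect_nonneg h hb]
  right_continuous' b :=
    ((hK.continuous_right a₂).sub (hK.continuous_right a₁)).continuousWithinAt

lemma strip_tendsto_atBot (hK : IsLipschitzCDF K) {a₁ a₂ : ℝ} (h : a₁ ≤ a₂) :
    Tendsto (hK.strip h) atBot (𝓝 0) := by
  refine tendsto_const_nhds.congr' ?_
  filter_upwards [eventually_le_atBot 0] with b hb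
  simp [strip, hK.eq_zero_right _ b hb]

lemma strip_tendsto_atTop (hK : IsLipschitzCDF K) {a₁ a₂ : ℝ} (h : a₁ ≤ a₂) :
    Tendsto (hK.strip h) atTop (𝓝 (K a₂ 1 - K a₁ 1)) := by
  refine tendsto_const_nhds.congr' ?_
  filter_upwards [eventually_ge_atTop 1] with b hb
  simp [strip, hK.eq_one_right _ b hb]

lemma grid_le (n i : ℕ) : (i : ℝ) / (n + 1) ≤ ((i + 1 : ℕ) : ℝ) / (n + 1) := by
  gcongr; simp

/-- The approximation of the measure with distribution function `K` that is carried by the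
vertical lines with abscissas in `{1 / (n + 1), …, 1}`. -/
def approx (hK : IsLipschitzCDF K) (n : ℕ) : Measure (ℝ × ℝ) :=
  ∑ i ∈ Finset.range (n + 1),
    (Measure.dirac (((i + 1 : ℕ) : ℝ) / (n + 1))).prod (hK.strip (grid_le n i)).measure

lemma approx_Iic_aux (hK : IsLipschitzCDF K) (n : ℕ) (a b : ℝ) :
    hK.approx n (Iic a ×ˢ Iic b) =
      ENNReal.ofReal (K ((min (n + 1) ⌊a * (n + 1)⌋₊ : ℕ) / (n + 1)) b) := by
  have hn : (0 : ℝ) < n + 1 := by positivity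
  have key := sum_range_ite_telescope (fun i ↦ K ((i : ℝ) / (n + 1)) b)
    (by simp [hK.eq_zero_left]) ⌊a * (n + 1)⌋₊ (n + 1)
  rw [← key, ENNReal.ofReal_sum_of_nonneg, approx, Measure.finsetSum_apply]
  · refine Finset.sum_congr rfl fun i _ ↦ ?_
    rw [Measure.prod_prod, StieltjesFunction.measure_Iic _ (hK.strip_tendsto_atBot _),
      Measure.dirac_apply' _ measurableSet_Iic, sub_zero]
    have : (((i + 1 : ℕ) : ℝ) / (n + 1)) ∈ Iic a ↔ i + 1 ≤ ⌊a * (n + 1)⌋₊ := by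
      rw [mem_Iic, div_le_iff₀ hn, Nat.le_floor_iff' (by simp)]
    by_cases h : i + 1 ≤ ⌊a * (n + 1)⌋₊
    · rw [indicator_of_mem (this.2 h), if_pos h]; simp [strip]
    · rw [indicator_of_notMem (mt this.1 h), if_neg h]; simp
  · intro i _
    split_ifs
    · exact (hK.strip (grid_le n i)).mono.le_of_tendsto (hK.strip_tendsto_atBot _) b
    · exact le_rfl

lemma abs_approx_sub_le (hK : IsLipschitzCDF K) (n : ℕ) (a b : ℝ) :
    |K ((min (n + 1) ⌊a * (n + 1)⌋₊ : ℕ) / (n + 1)) b - K a b| ≤ 1 / (n + 1) := by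
  have hn : (0 : ℝ) < n + 1 := by positivity
  rcases le_total a 0 with ha | ha
  · rw [Nat.floor_of_nonpos (mul_nonpos_of_nonpos_of_nonneg ha hn.le)]
    simp only [zero_le, inf_of_le_right, CharP.cast_eq_zero, zero_div]
    rw [hK.eq_zero_left 0 le_rfl, hK.eq_zero_left a ha]
    simp; positivity
  have hf := Nat.floor_le (mul_nonneg ha hn.le)
  have hf' := Nat.lt_floor_add_one (a * (n + 1))
  rcases le_total 1 a with ha' | ha'
  · rw [min_eq_left (Nat.le_floor (by push_cast; nlinarith)), hK.eq_one_left a ha']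
    push_cast
    rw [div_self hn.ne']
    simp; positivity
  · refine (hK.abs_sub_left_le _ _ _).trans ?_
    rw [min_eq_right]
    · rw [div_sub' hn.ne', abs_div, abs_of_pos hn]
      gcongr
      rw [abs_le]; constructor <;> linarith
    · have : (⌊a * (n + 1)⌋₊ : ℝ) ≤ (n + 1 : ℕ) := by push_cast; nlinarith
      exact_mod_cast this

lemma approx_tendsto (hK : IsLipschitzCDF K) (a b : ℝ) :
    Tendsto (fun n ↦ hK.approx n (Iic a ×ˢ Iic b)) atTop (𝓝 (ENNReal.ofReal (K a b))) := by
  simp_rw [approx_Iic_aux]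
  refine ENNReal.tendsto_ofReal ?_
  rw [tendsto_iff_norm_sub_tendsto_zero]
  exact squeeze_zero (fun _ ↦ norm_nonneg _) (fun n ↦ hK.abs_approx_sub_le n a b)
    tendsto_one_div_add_atTop_nhds_zero_nat

lemma approx_univ (hK : IsLipschitzCDF K) (n : ℕ) : hK.approx n univ = 1 := by
  have hn : (0 : ℝ) < n + 1 := by positivity
  have key := Finset.sum_range_sub (fun i ↦ K ((i : ℝ) / (n + 1)) 1) (n + 1)
  rw [approx, Measure.finsetSum_apply]
  rw [← univ_prod_univ]
  simp_rw [Measure.prod_prod, measure_univ, one_mul,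
    StieltjesFunction.measure_univ _ (hK.strip_tendsto_atBot _) (hK.strip_tendsto_atTop _)]
  rw [← ENNReal.ofReal_sum_of_nonneg]
  · simp only [sub_zero]
    rw [key]
    simp [hK.eq_zero_left, div_self hn.ne', hK.one_one]
  · intro i _
    have := hK.rect_nonneg (grid_le n i) zero_le_one
    simpa [hK.eq_zero_right] using this

lemma approx_compl_square (hK : IsLipschitzCDF K) (n : ℕ) :
    hK.approx n (Icc 0 1 ×ˢ Icc 0 1)ᶜ = 0 := by
  have hn : (0 : ℝ) < n + 1 := by positivity
  have : IsProbabilityMeasure (hK.approx n) := ⟨hK.approx_univ n⟩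
  have h₁ : hK.approx n (Iic 1 ×ˢ Iic 1)ᶜ = 0 := by
    rw [prob_compl_eq_zero_iff (measurableSet_Iic.prod measurableSet_Iic), approx_Iic_aux,
      min_eq_left (Nat.le_floor (by simp))]
    push_cast
    rw [div_self hn.ne', hK.one_one, ENNReal.ofReal_one]
  have h₂ : hK.approx n (Iic 0 ×ˢ Iic 1) = 0 := by
    rw [approx_Iic_aux]; simp [hK.eq_zero_left]
  have h₃ : hK.approx n (Iic 1 ×ˢ Iic 0) = 0 := by
    rw [approx_Iic_aux]; simp [hK.eq_zero_right]
  refine measure_mono_null ?_ (measure_union_null h₁ (measure_union_null h₂ h₃))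
  rintro ⟨x, y⟩ h
  simp only [mem_compl_iff, mem_prod, mem_Icc, mem_union, mem_Iic] at *
  grind

/-- Every such function is the distribution function of a probability measure. -/
theorem exists_probabilityMeasure (hK : IsLipschitzCDF K) :
    ∃ μ : ProbabilityMeasure (ℝ × ℝ), ∀ a b,
      (μ : Measure (ℝ × ℝ)) (Iic a ×ˢ Iic b) = ENNReal.ofReal (K a b) := by
  let ν (n : ℕ) : ProbabilityMeasure (ℝ × ℝ) := ⟨hK.approx n, ⟨hK.approx_univ n⟩⟩
  have hc := isCompact_setOfPred_probabilityMeasure_mass_eq_compl_isCompact_le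
    (E := ℝ × ℝ) (u := fun _ ↦ 0) (K := fun _ ↦ Icc (0 : ℝ) 1 ×ˢ Icc (0 : ℝ) 1)
    tendsto_const_nhds (fun _ ↦ isCompact_Icc.prod isCompact_Icc) (Or.inr monotone_const)
  obtain ⟨μ, -, hμ⟩ := hc.ultrafilter_le_nhds ((hyperfilter ℕ : Ultrafilter ℕ).map ν) (by
    refine le_principal_iff.2 (Filter.mem_map.2 (univ_mem' fun n _ ↦ ?_))
    have h := hK.approx_compl_square n
    rw [Icc_prod_Icc] at h
    simp [ν, h])
  replace hμ : Tendsto ν (hyperfilter ℕ) (𝓝 μ) := hμ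
  have hlim (a b : ℝ) : Tendsto (fun n ↦ (ν n : Measure (ℝ × ℝ)) (Iic a ×ˢ Iic b))
      (hyperfilter ℕ) (𝓝 (ENNReal.ofReal (K a b))) :=
    (hK.approx_tendsto a b).mono_left Nat.hyperfilter_le_atTop
  refine ⟨μ, fun a b ↦ le_antisymm ?_ ?_⟩
  · have hle (ε : ℝ) (hε : 0 < ε) :
        (μ : Measure (ℝ × ℝ)) (Iic a ×ˢ Iic b) ≤ ENNReal.ofReal (K (a + ε) (b + ε)) := by
      calc (μ : Measure (ℝ × ℝ)) (Iic a ×ˢ Iic b)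
          ≤ (μ : Measure (ℝ × ℝ)) (Iio (a + ε) ×ˢ Iio (b + ε)) :=
            measure_mono (prod_mono (Iic_subset_Iio.2 (by linarith))
              (Iic_subset_Iio.2 (by linarith)))
        _ ≤ (hyperfilter ℕ : Filter ℕ).liminf
              fun n ↦ (ν n : Measure (ℝ × ℝ)) (Iio (a + ε) ×ˢ Iio (b + ε)) :=
            ProbabilityMeasure.le_liminf_measure_open_of_tendsto hμ (isOpen_Iio.prod isOpen_Iio)
        _ ≤ (hyperfilter ℕ : Filter ℕ).liminf
              fun n ↦ (ν n : Measure (ℝ × ℝ)) (Iic (a + ε) ×ˢ Iic (b + ε)) :=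
            liminf_le_liminf (Eventually.of_forall fun n ↦
              measure_mono (prod_mono Iio_subset_Iic_self Iio_subset_Iic_self))
        _ = _ := (hlim _ _).liminf_eq
    have hK' : Tendsto (fun ε : ℝ ↦ ENNReal.ofReal (K (a + ε) (b + ε))) (𝓝[>] 0)
        (𝓝 (ENNReal.ofReal (K a b))) := by
      refine ENNReal.tendsto_ofReal (Tendsto.mono_left ?_ nhdsWithin_le_nhds)
      rw [tendsto_iff_norm_sub_tendsto_zero]
      refine squeeze_zero (g := fun ε ↦ |ε| + |ε|) (fun _ ↦ norm_nonneg _) (fun ε ↦ ?_) ?_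
      · have h₁ := hK.abs_sub_left_le (a + ε) a (b + ε)
        have h₂ := hK.abs_sub_right_le a (b + ε) b
        rw [add_sub_cancel_left] at h₁ h₂
        exact (_root_.abs_sub_le _ (K a (b + ε)) _).trans (add_le_add h₁ h₂)
      · have : Continuous fun ε : ℝ ↦ |ε| + |ε| := by fun_prop
        simpa using this.tendsto 0
    exact ge_of_tendsto hK' (eventually_mem_nhdsWithin.mono fun ε hε ↦ hle ε hε)
  · rw [← (hlim a b).limsup_eq]
    exact ProbabilityMeasure.limsup_measure_closed_le_of_tendsto hμ (isClosed_Iic.prod isClosed_Iic)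

end IsLipschitzCDF

/-! ### Basic properties of permutons -/

/-- The projection of the real line onto the unit interval. -/
def clamp (a : ℝ) : ℝ := max (min a 1) 0

lemma clamp_mem (a : ℝ) : clamp a ∈ Icc (0 : ℝ) 1 := by
  unfold clamp; constructor <;> grind

lemma clamp_of_mem {a : ℝ} (ha : a ∈ Icc (0 : ℝ) 1) : clamp a = a := by
  unfold clamp; grind

lemma clamp_mono : Monotone clamp := fun a b h ↦ by
  unfold clamp; gcongr

lemma clamp_of_nonpos {a : ℝ} (ha : a ≤ 0) : clamp a = 0 := by
  unfold clamp; grind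

lemma clamp_of_one_le {a : ℝ} (ha : 1 ≤ a) : clamp a = 1 := by
  unfold clamp; grind

lemma abs_clamp_sub_le (a b : ℝ) : |clamp a - clamp b| ≤ |a - b| := by
  unfold clamp; grind

/-- The mass of the quadrant `(-∞, a] × [b, ∞)`. -/
def upperLeft (μ : Measure (ℝ × ℝ)) (a b : ℝ) : ℝ :=
  μ.real (Iic a ×ˢ Ici b)

namespace IsPermuton

variable {μ : Measure (ℝ × ℝ)} {a b : ℝ}

lemma ae_mem_Ioo (h : IsPermuton μ) :
    ∀ᵐ p ∂μ, p.1 ∈ Ioo (0 : ℝ) 1 ∧ p.2 ∈ Ioo (0 : ℝ) 1 := by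
  have hI : ∀ᵐ x ∂(volume.restrict (Icc (0 : ℝ) 1)), x ∈ Ioo (0 : ℝ) 1 := by
    rw [← restrict_Ioo_eq_restrict_Icc]
    exact ae_restrict_mem measurableSet_Ioo
  have h₁ := ae_of_ae_map measurable_fst.aemeasurable (h.2.1 ▸ hI)
  have h₂ := ae_of_ae_map measurable_snd.aemeasurable (h.2.2 ▸ hI)
  filter_upwards [h₁, h₂] with p hp hq using ⟨hp, hq⟩

lemma ae_fst_ne (h : IsPermuton μ) (a : ℝ) : ∀ᵐ p ∂μ, p.1 ≠ a :=
  ae_of_ae_map measurable_fst.aemeasurable (by rw [h.2.1]; exact Measure.ae_ne _ a)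

lemma ae_snd_ne (h : IsPermuton μ) (b : ℝ) : ∀ᵐ p ∂μ, p.2 ≠ b :=
  ae_of_ae_map measurable_snd.aemeasurable (by rw [h.2.2]; exact Measure.ae_ne _ b)

lemma volume_real_Iic (a : ℝ) : (volume.restrict (Icc (0 : ℝ) 1)).real (Iic a) = clamp a := by
  have : Iic a ∩ Icc (0 : ℝ) 1 = Icc 0 (min a 1) := by
    ext x; simp only [mem_inter_iff, mem_Iic, mem_Icc, le_min_iff]; tauto
  rw [measureReal_restrict_apply measurableSet_Iic, this, Real.volume_real_Icc, sub_zero, clamp]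

lemma real_fst_Iic (h : IsPermuton μ) (a : ℝ) : μ.real (Iic a ×ˢ univ) = clamp a := by
  rw [prod_univ, ← map_measureReal_apply measurable_fst measurableSet_Iic, h.2.1, volume_real_Iic]

lemma real_snd_Iio (h : IsPermuton μ) (b : ℝ) : μ.real (univ ×ˢ Iio b) = clamp b := by
  rw [univ_prod, ← map_measureReal_apply measurable_snd measurableSet_Iio, h.2.2,
    measureReal_congr Iio_ae_eq_Iic, volume_real_Iic]

lemma real_Iic_prod_Iio (h : IsPermuton μ) (a b : ℝ) :
    μ.real (Iic a ×ˢ Iio b) = clamp a - upperLeft μ a b := by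
  have := h.1
  rw [← h.real_fst_Iic, upperLeft, ← Iio_union_Ici (a := b), prod_union,
    measureReal_union (Disjoint.set_prod_right (by simp) _ _)
      (measurableSet_Iic.prod measurableSet_Ici)]
  ring

lemma real_Ioi_prod_Iio (h : IsPermuton μ) (a b : ℝ) :
    μ.real (Ioi a ×ˢ Iio b) = clamp b - clamp a + upperLeft μ a b := by
  have := h.1
  have h₁ := h.real_snd_Iio b
  rw [← Iic_union_Ioi (a := a), union_prod,
    measureReal_union (Disjoint.set_prod_left (Iic_disjoint_Ioi le_rfl) _ _)
      (measurableSet_Ioi.prod measurableSet_Iio), h.real_Iic_prod_Iio] at h₁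
  linarith

lemma real_Iic_prod_Ico (h : IsPermuton μ) (a : ℝ) {b₁ b₂ : ℝ} (hb : b₁ ≤ b₂) :
    μ.real (Iic a ×ˢ Ico b₁ b₂) = upperLeft μ a b₁ - upperLeft μ a b₂ := by
  have := h.1
  have hd : Disjoint (Ico b₁ b₂) (Ici b₂) :=
    disjoint_left.2 fun x h₁ h₂ ↦ absurd h₁.2 (not_lt.2 h₂)
  rw [upperLeft, upperLeft, ← Ico_union_Ici_eq_Ici hb, prod_union,
    measureReal_union (Disjoint.set_prod_right hd _ _)
      (measurableSet_Iic.prod measurableSet_Ici)]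
  ring

lemma real_Ioc_prod_Ici (h : IsPermuton μ) {a₁ a₂ : ℝ} (ha : a₁ ≤ a₂) (b : ℝ) :
    μ.real (Ioc a₁ a₂ ×ˢ Ici b) = upperLeft μ a₂ b - upperLeft μ a₁ b := by
  have := h.1
  rw [upperLeft, upperLeft, ← Iic_union_Ioc_eq_Iic ha, union_prod,
    measureReal_union (Disjoint.set_prod_left (by simp) _ _)
      (measurableSet_Ioc.prod measurableSet_Ici)]
  ring

lemma real_Ioc_prod_Ico (h : IsPermuton μ) {a₁ a₂ b₁ b₂ : ℝ} (ha : a₁ ≤ a₂) (hb : b₁ ≤ b₂) :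
    μ.real (Ioc a₁ a₂ ×ˢ Ico b₁ b₂) =
      upperLeft μ a₂ b₁ - upperLeft μ a₂ b₂ - (upperLeft μ a₁ b₁ - upperLeft μ a₁ b₂) := by
  have := h.1
  rw [← h.real_Iic_prod_Ico a₂ hb, ← h.real_Iic_prod_Ico a₁ hb, ← Iic_union_Ioc_eq_Iic ha,
    union_prod, measureReal_union (Disjoint.set_prod_left (by simp) _ _)
      (measurableSet_Ioc.prod measurableSet_Ico)]
  ring

lemma upperLeft_clamp (h : IsPermuton μ) (a b : ℝ) :
    upperLeft μ (clamp a) (clamp b) = upperLeft μ a b := by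
  refine measureReal_congr ?_
  filter_upwards [h.ae_mem_Ioo] with p ⟨h₁, h₂⟩
  refine propext ?_
  change (p.1 ≤ clamp a ∧ clamp b ≤ p.2) ↔ (p.1 ≤ a ∧ b ≤ p.2)
  unfold clamp
  grind

lemma upperLeft_zero_right (h : IsPermuton μ) (ha : a ∈ Icc (0 : ℝ) 1) : upperLeft μ a 0 = a := by
  have h₁ := h.real_Iic_prod_Iio a 0
  have h₂ : μ (Iic a ×ˢ Iio 0) = 0 := by
    refine measure_eq_zero_iff_ae_notMem.2 ?_
    filter_upwards [h.ae_mem_Ioo] with p hp hp'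
    exact absurd hp.2.1 (not_lt.2 (le_of_lt hp'.2))
  rw [measureReal_def, h₂, clamp_of_mem ha] at h₁
  simp at h₁; linarith

lemma upperLeft_nonneg (μ : Measure (ℝ × ℝ)) (a b : ℝ) : 0 ≤ upperLeft μ a b :=
  measureReal_nonneg

lemma upperLeft_antitone (h : IsPermuton μ) (a : ℝ) : Antitone (upperLeft μ a) := fun b₁ b₂ hb ↦ by
  have := h.real_Iic_prod_Ico a hb
  linarith [measureReal_nonneg (μ := μ) (s := Iic a ×ˢ Ico b₁ b₂)]

lemma continuous_upperLeft (h : IsPermuton μ) (a : ℝ) : Continuous (upperLeft μ a) := by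
  refine (LipschitzWith.of_le_add fun b₁ b₂ ↦ ?_).continuous
  rcases le_total b₂ b₁ with hb | hb
  · exact (h.upperLeft_antitone a hb).trans (le_add_of_nonneg_right dist_nonneg)
  have := h.1
  have h₁ := h.real_Iic_prod_Ico a hb
  have h₂ : μ.real (Iic a ×ˢ Ico b₁ b₂) ≤ clamp b₂ - clamp b₁ := by
    have hd : Disjoint (Iio b₁) (Ico b₁ b₂) :=
      disjoint_left.2 fun x h₁ h₂ ↦ absurd h₂.1 (not_le.2 h₁)
    rw [← h.real_snd_Iio, ← h.real_snd_Iio, ← Iio_union_Ico_eq_Iio hb, prod_union,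
      measureReal_union (Disjoint.set_prod_right hd _ _)
        (MeasurableSet.univ.prod measurableSet_Ico), add_sub_cancel_left]
    exact measureReal_mono (prod_mono (subset_univ _) subset_rfl)
  have h₃ := (le_abs_self _).trans (abs_clamp_sub_le b₂ b₁)
  rw [dist_comm, Real.dist_eq]
  linarith

/-- Convergence of the masses of upper-left quadrants implies weak convergence. -/
theorem tendsto_of_upperLeft {ι : Type*} {l : Filter ι} [l.IsCountablyGenerated]
    {μ : ι → ProbabilityMeasure (ℝ × ℝ)} {ν : ProbabilityMeasure (ℝ × ℝ)}
    (hμ : ∀ i, IsPermuton (μ i : Measure (ℝ × ℝ))) (hν : IsPermuton (ν : Measure (ℝ × ℝ)))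
    (hlim : ∀ a ∈ Icc (0 : ℝ) 1, ∀ b ∈ Icc (0 : ℝ) 1,
      Tendsto (fun i ↦ upperLeft (μ i) a b) l (𝓝 (upperLeft ν a b))) :
    Tendsto μ l (𝓝 ν) := by
  have hlim' (a b : ℝ) : Tendsto (fun i ↦ upperLeft (μ i) a b) l (𝓝 (upperLeft ν a b)) := by
    simp_rw [← (hμ _).upperLeft_clamp a b, ← hν.upperLeft_clamp a b]
    exact hlim _ (clamp_mem a) _ (clamp_mem b)
  refine IsPiSystem.tendsto_probabilityMeasure_of_tendsto_of_mem
    (S := {s | ∃ a₁ a₂ b₁ b₂ : ℝ, a₁ ≤ a₂ ∧ b₁ ≤ b₂ ∧ s = Ioc a₁ a₂ ×ˢ Ico b₁ b₂}) ?_ ?_ ?_ ?_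
  · rintro _ ⟨a₁, a₂, b₁, b₂, -, -, rfl⟩ _ ⟨a₁', a₂', b₁', b₂', -, -, rfl⟩ hne
    rw [prod_inter_prod, Ioc_inter_Ioc, Ico_inter_Ico] at hne ⊢
    obtain ⟨p, ⟨hp₁, hp₂⟩, hp₃, hp₄⟩ := hne
    exact ⟨_, _, _, _, (hp₁.trans_le hp₂).le, hp₃.trans hp₄.le, rfl⟩
  · rintro _ ⟨a₁, a₂, b₁, b₂, -, -, rfl⟩
    exact measurableSet_Ioc.prod measurableSet_Ico
  · rintro u hu ⟨x, y⟩ hxy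
    obtain ⟨ε, hε, hball⟩ := Metric.isOpen_iff.1 hu _ hxy
    refine ⟨_, ⟨x - ε / 2, x + ε / 2, y - ε / 2, y + ε / 2, by linarith, by linarith, rfl⟩,
      prod_mem_nhds (Ioc_mem_nhds (by linarith) (by linarith))
        (Ico_mem_nhds (by linarith) (by linarith)), fun p hp ↦ hball ?_⟩
    obtain ⟨⟨h₁, h₂⟩, h₃, h₄⟩ := hp
    rw [Metric.mem_ball, Prod.dist_eq, Real.dist_eq, Real.dist_eq, max_lt_iff, abs_lt, abs_lt]
    exact ⟨⟨by linarith, by linarith⟩, by linarith, by linarith⟩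
  · rintro _ ⟨a₁, a₂, b₁, b₂, ha, hb, rfl⟩
    rw [← NNReal.tendsto_coe]
    change Tendsto (fun i ↦ (μ i : Measure (ℝ × ℝ)).real _) l
      (𝓝 ((ν : Measure (ℝ × ℝ)).real _))
    simp_rw [(hμ _).real_Ioc_prod_Ico ha hb, hν.real_Ioc_prod_Ico ha hb]
    exact ((hlim' _ _).sub (hlim' _ _)).sub ((hlim' _ _).sub (hlim' _ _))

end IsPermuton

/-! ### The excursion of a permuton -/

/-- The height at `t` of the excursion associated with a permuton. -/
def excursionHeight (μ : Measure (ℝ × ℝ)) (t : ℝ) : ℝ :=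
  sInf {u : ℝ | 0 ≤ u ∧ μ (Ioi (t + u) ×ˢ Iio (t - u)) = 0}

lemma measure_Ioi_prod_Iio_eq_zero {μ : Measure (ℝ × ℝ)} {a b : ℝ}
    (h : ∀ ε > 0, μ (Ioi (a + ε) ×ˢ Iio (b - ε)) = 0) : μ (Ioi a ×ˢ Iio b) = 0 := by
  have h₁ : μ (⋃ n : ℕ, Ioi (a + 1 / ((n : ℝ) + 1)) ×ˢ Iio (b - 1 / ((n : ℝ) + 1))) = 0 :=
    measure_iUnion_null fun n ↦ h _ Nat.one_div_pos_of_nat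
  refine measure_mono_null (fun p hp ↦ ?_) h₁
  obtain ⟨hp₁, hp₂⟩ := hp
  obtain ⟨n, hn⟩ := exists_nat_one_div_lt
    (lt_min (sub_pos.2 (mem_Ioi.1 hp₁)) (sub_pos.2 (mem_Iio.1 hp₂)))
  rw [lt_min_iff] at hn
  exact mem_iUnion.2 ⟨n, by simp only [mem_Ioi]; linarith, by simp only [mem_Iio]; linarith⟩

lemma excursionHeight_nonneg (μ : Measure (ℝ × ℝ)) (t : ℝ) : 0 ≤ excursionHeight μ t :=
  Real.sInf_nonneg fun _ hu ↦ hu.1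

namespace IsPermuton

variable {μ : Measure (ℝ × ℝ)} {a b t u x y : ℝ}

lemma Ioi_prod_Iio_null_of_nonpos (h : IsPermuton μ) (a : ℝ) (hb : b ≤ 0) :
    μ (Ioi a ×ˢ Iio b) = 0 := by
  refine measure_eq_zero_iff_ae_notMem.2 ?_
  filter_upwards [h.ae_mem_Ioo] with p hp hp'
  exact absurd hp.2.1 (not_lt.2 ((le_of_lt hp'.2).trans hb))

lemma Ioi_prod_Iio_null_of_one_le (h : IsPermuton μ) (ha : 1 ≤ a) (b : ℝ) :
    μ (Ioi a ×ˢ Iio b) = 0 := by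
  refine measure_eq_zero_iff_ae_notMem.2 ?_
  filter_upwards [h.ae_mem_Ioo] with p hp hp'
  exact absurd hp.1.2 (not_lt.2 (ha.trans (le_of_lt hp'.1)))

lemma excursionHeight_le (hu : 0 ≤ u) (h : μ (Ioi (t + u) ×ˢ Iio (t - u)) = 0) :
    excursionHeight μ t ≤ u :=
  csInf_le ⟨0, fun _ hv ↦ hv.1⟩ ⟨hu, h⟩

lemma Ioi_prod_Iio_null (h : IsPermuton μ) (t : ℝ) :
    μ (Ioi (t + excursionHeight μ t) ×ˢ Iio (t - excursionHeight μ t)) = 0 := by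
  refine measure_Ioi_prod_Iio_eq_zero fun ε hε ↦ ?_
  have hne : {u : ℝ | 0 ≤ u ∧ μ (Ioi (t + u) ×ˢ Iio (t - u)) = 0}.Nonempty :=
    ⟨|t|, abs_nonneg t, h.Ioi_prod_Iio_null_of_nonpos _ (by linarith [le_abs_self t])⟩
  obtain ⟨u, ⟨-, hu⟩, hlt⟩ := exists_lt_of_csInf_lt hne
    (show excursionHeight μ t < excursionHeight μ t + ε by linarith)
  exact measure_mono_null (prod_mono (Ioi_subset_Ioi (by linarith))
    (Iio_subset_Iio (by linarith))) hu

lemma excursionHeight_le_add (h : IsPermuton μ) (s t : ℝ) :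
    excursionHeight μ s ≤ excursionHeight μ t + |s - t| := by
  have := neg_abs_le (s - t)
  have := le_abs_self (s - t)
  refine excursionHeight_le (add_nonneg (excursionHeight_nonneg μ t) (abs_nonneg _)) ?_
  exact measure_mono_null (prod_mono (Ioi_subset_Ioi (by linarith))
    (Iio_subset_Iio (by linarith))) (h.Ioi_prod_Iio_null t)

lemma excursionHeight_le_self (h : IsPermuton μ) (ht : 0 ≤ t) : excursionHeight μ t ≤ t :=
  excursionHeight_le ht (h.Ioi_prod_Iio_null_of_nonpos _ (by linarith))

lemma excursionHeight_le_one_sub (h : IsPermuton μ) (ht : t ≤ 1) : excursionHeight μ t ≤ 1 - t :=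
  excursionHeight_le (by linarith) (h.Ioi_prod_Iio_null_of_one_le (by linarith) _)

lemma excursionHeight_of_nonpos (h : IsPermuton μ) (ht : t ≤ 0) : excursionHeight μ t = 0 :=
  (excursionHeight_le le_rfl (h.Ioi_prod_Iio_null_of_nonpos _ (by linarith))).antisymm
    (excursionHeight_nonneg μ t)

lemma excursionHeight_of_one_le (h : IsPermuton μ) (ht : 1 ≤ t) : excursionHeight μ t = 0 :=
  (excursionHeight_le le_rfl (h.Ioi_prod_Iio_null_of_one_le (by linarith) _)).antisymm
    (excursionHeight_nonneg μ t)

lemma lipschitzWith_excursionHeight (h : IsPermuton μ) :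
    LipschitzWith 1 (excursionHeight μ) :=
  LipschitzWith.of_le_add h.excursionHeight_le_add

/-- The excursion associated with a permuton. -/
def excursion (h : IsPermuton μ) : BoundedContinuousFunction ℝ ℝ :=
  BoundedContinuousFunction.ofNormedAddCommGroup (excursionHeight μ)
    h.lipschitzWith_excursionHeight.continuous 1 fun t ↦ by
      rw [Real.norm_of_nonneg (excursionHeight_nonneg μ t)]
      rcases le_total t 1 with ht | ht
      · rcases le_total 0 t with ht' | ht'
        · linarith [h.excursionHeight_le_one_sub ht]
        · linarith [h.excursionHeight_of_nonpos ht']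
      · linarith [h.excursionHeight_of_one_le ht]

lemma isExcursion_excursion (h : IsPermuton μ) : IsExcursion h.excursion :=
  ⟨h.lipschitzWith_excursionHeight, excursionHeight_nonneg μ, h.excursionHeight_of_nonpos le_rfl,
    h.excursionHeight_of_one_le le_rfl, fun t ht ↦ by
      rcases le_total t 0 with h₀ | h₀
      · exact h.excursionHeight_of_nonpos h₀
      · rcases le_total 1 t with h₁ | h₁
        · exact h.excursionHeight_of_one_le h₁
        · exact absurd ⟨h₀, h₁⟩ ht⟩

lemma le_RLMcurve (h : IsPermuton μ) (hy₀ : 0 ≤ y) (hy₁ : y ≤ 1) (hxy : μ (Ioi x ×ˢ Iio y) = 0) :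
    y ≤ RLMcurve μ x := by
  refine le_csSup ⟨1, fun _ hz ↦ hz.1.2⟩ ⟨⟨hy₀, hy₁⟩, ?_⟩
  refine measure_eq_zero_iff_ae_notMem.2 ?_
  filter_upwards [measure_eq_zero_iff_ae_notMem.1 hxy, h.ae_fst_ne x, h.ae_snd_ne y]
    with p hp h₁ h₂ hp'
  exact hp ⟨lt_of_le_of_ne hp'.1.1 h₁.symm, lt_of_le_of_ne hp'.2.2 h₂⟩

lemma zero_mem_RLM (h : IsPermuton μ) (x : ℝ) :
    (0 : ℝ) ∈ {y : ℝ | y ∈ Icc (0:ℝ) 1 ∧ μ (Icc x 1 ×ˢ Icc 0 y) = 0} := by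
  refine ⟨⟨le_rfl, zero_le_one⟩, measure_eq_zero_iff_ae_notMem.2 ?_⟩
  filter_upwards [h.ae_mem_Ioo] with p hp hp'
  exact absurd hp.2.1 (not_lt.2 hp'.2.2)

lemma RLMcurve_mem (h : IsPermuton μ) (x : ℝ) : RLMcurve μ x ∈ Icc (0 : ℝ) 1 :=
  ⟨le_csSup ⟨1, fun _ hz ↦ hz.1.2⟩ (h.zero_mem_RLM x),
    csSup_le ⟨0, h.zero_mem_RLM x⟩ fun _ hz ↦ hz.1.2⟩

lemma Ioi_prod_Iio_null_of_le_RLMcurve (h : IsPermuton μ) (hxy : y ≤ RLMcurve μ x) :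
    μ (Ioi x ×ˢ Iio y) = 0 := by
  refine measure_Ioi_prod_Iio_eq_zero fun ε hε ↦ ?_
  obtain ⟨z, ⟨-, hz⟩, hlt⟩ := exists_lt_of_lt_csSup ⟨0, h.zero_mem_RLM x⟩
    (show y - ε < RLMcurve μ x by linarith)
  refine measure_eq_zero_iff_ae_notMem.2 ?_
  filter_upwards [measure_eq_zero_iff_ae_notMem.1 hz, h.ae_mem_Ioo] with p hp hp₀ hp'
  obtain ⟨hp₁, hp₂⟩ := hp'
  rw [mem_Ioi] at hp₁
  rw [mem_Iio] at hp₂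
  exact hp ⟨⟨by linarith, hp₀.1.2.le⟩, hp₀.2.1.le, by linarith⟩

lemma monotone_RLMcurve (h : IsPermuton μ) : Monotone (RLMcurve μ) := fun x _ hx ↦
  h.le_RLMcurve (h.RLMcurve_mem x).1 (h.RLMcurve_mem x).2 <|
    measure_mono_null (prod_mono (Ioi_subset_Ioi hx) subset_rfl)
      (h.Ioi_prod_Iio_null_of_le_RLMcurve (y := RLMcurve μ x) le_rfl)

lemma RLMcurve_le_clamp (h : IsPermuton μ) (x : ℝ) : RLMcurve μ x ≤ clamp x := by
  have h₁ := h.real_Ioi_prod_Iio x (RLMcurve μ x)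
  rw [measureReal_def, h.Ioi_prod_Iio_null_of_le_RLMcurve le_rfl, ENNReal.toReal_zero,
    clamp_of_mem (h.RLMcurve_mem x)] at h₁
  linarith [upperLeft_nonneg μ x (RLMcurve μ x)]

lemma leftLim_RLMcurve_le_iff (h : IsPermuton μ) :
    Function.leftLim (RLMcurve μ) x ≤ y ↔ ∀ x' < x, RLMcurve μ x' ≤ y := by
  refine ⟨fun hxy x' hx' ↦ (h.monotone_RLMcurve.le_leftLim hx').trans hxy, fun hxy ↦ ?_⟩
  rw [h.monotone_RLMcurve.leftLim_eq_sSup]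
  exact csSup_le (nonempty_Iio.image _) (by rintro _ ⟨x', hx', rfl⟩; exact hxy x' hx')

/-- The completed graph of the RLM curve of a permuton is the graph of its excursion. -/
theorem completedGraph_RLMcurve (h : IsPermuton μ) :
    completedGraph (RLMcurve μ) = excursionGraph (excursionHeight μ) := by
  ext ⟨x, y⟩
  constructor
  · rintro ⟨⟨hx₀, hx₁⟩, hy, hyx⟩
    dsimp only at hx₀ hx₁ hy hyx
    have hfx := h.RLMcurve_le_clamp x
    rw [clamp_of_mem ⟨hx₀, hx₁⟩] at hfx
    have hy₀ : 0 ≤ y := (h.RLMcurve_mem (x - 1)).1.trans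
      (h.leftLim_RLMcurve_le_iff.1 hy _ (by linarith))
    have hle : excursionHeight μ ((x + y) / 2) ≤ (x - y) / 2 := by
      refine excursionHeight_le (by linarith) ?_
      rw [show (x + y) / 2 + (x - y) / 2 = x by ring, show (x + y) / 2 - (x - y) / 2 = y by ring]
      exact h.Ioi_prod_Iio_null_of_le_RLMcurve hyx
    have heq : excursionHeight μ ((x + y) / 2) = (x - y) / 2 := by
      by_contra hne
      have hlt := lt_of_le_of_ne hle hne
      have h₁ := h.leftLim_RLMcurve_le_iff.1 hy ((x + y) / 2 + excursionHeight μ ((x + y) / 2))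
        (by linarith)
      have h₂ := h.le_RLMcurve (by linarith)
        (by linarith [excursionHeight_nonneg μ ((x + y) / 2)])
        (h.Ioi_prod_Iio_null ((x + y) / 2))
      linarith
    refine ⟨(x + y) / 2, ⟨by linarith, by linarith⟩, ?_⟩
    rw [heq, Prod.mk.injEq]
    constructor <;> ring
  · rintro ⟨t, ⟨ht₀, ht₁⟩, hxy⟩
    obtain ⟨rfl, rfl⟩ := Prod.mk.inj hxy
    have hu₀ := excursionHeight_nonneg μ t
    have hu₁ := h.excursionHeight_le_self ht₀
    have hu₂ := h.excursionHeight_le_one_sub ht₁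
    refine ⟨⟨by dsimp only; linarith, by dsimp only; linarith⟩,
      h.leftLim_RLMcurve_le_iff.2 fun x' hx' ↦ ?_,
      h.le_RLMcurve (by linarith) (by linarith) (h.Ioi_prod_Iio_null t)⟩
    dsimp only at hx' ⊢
    by_contra! hlt
    rcases hu₀.eq_or_lt with hu | hu
    · have h₁ := h.RLMcurve_le_clamp x'
      rw [← hu] at hlt hx'
      have h₂ : clamp x' ≤ t := by unfold clamp; grind
      linarith
    · have hle : excursionHeight μ t ≤ max 0 (max (x' - t) (t - RLMcurve μ x')) := by
        refine excursionHeight_le (le_max_left _ _) (measure_mono_null (prod_mono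
          (Ioi_subset_Ioi ?_) (Iio_subset_Iio ?_))
          (h.Ioi_prod_Iio_null_of_le_RLMcurve (x := x') le_rfl)) <;> grind
      grind

end IsPermuton

/-! ### The masses of the quadrants are determined by the excursion -/

lemma PermutonAvoids231.null_of_forall {μ : Measure (ℝ × ℝ)} [SFinite μ]
    (hμ : PermutonAvoids231 μ) {A B C : Set (ℝ × ℝ)}
    (h : ∀ p ∈ A, ∀ q ∈ B, ∀ r ∈ C, p.1 < q.1 ∧ q.1 < r.1 ∧ r.2 < p.2 ∧ p.2 < q.2) :
    μ A = 0 ∨ μ B = 0 ∨ μ C = 0 := by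
  have h₁ : (μ.prod (μ.prod μ)) (A ×ˢ (B ×ˢ C)) = 0 :=
    measure_mono_null (fun t ht ↦ h _ ht.1 _ ht.2.1 _ ht.2.2) hμ
  simpa [Measure.prod_prod] using h₁

namespace IsPermuton

variable {μ : Measure (ℝ × ℝ)} {a b r : ℝ}

lemma upperLeft_le_add_left (h : IsPermuton μ) (a₁ a₂ b : ℝ) :
    upperLeft μ a₂ b ≤ upperLeft μ a₁ b + max (a₂ - a₁) 0 := by
  have := h.1
  rcases le_total a₁ a₂ with ha | ha
  · have h₁ : μ.real (Iic a₁ ×ˢ Iio b) ≤ μ.real (Iic a₂ ×ˢ Iio b) :=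
      measureReal_mono (prod_mono (Iic_subset_Iic.2 ha) subset_rfl)
    rw [h.real_Iic_prod_Iio, h.real_Iic_prod_Iio] at h₁
    linarith [(le_abs_self _).trans (abs_clamp_sub_le a₂ a₁), abs_of_nonneg (sub_nonneg.2 ha),
      le_max_left (a₂ - a₁) 0]
  · have h₁ := h.real_Ioc_prod_Ici ha b
    linarith [measureReal_nonneg (μ := μ) (s := Ioc a₂ a₁ ×ˢ Ici b), le_max_right (a₂ - a₁) 0]

lemma upperLeft_le_add_right (h : IsPermuton μ) (a b₁ b₂ : ℝ) :
    upperLeft μ a b₁ ≤ upperLeft μ a b₂ + max (b₂ - b₁) 0 := by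
  have := h.1
  rcases le_total b₁ b₂ with hb | hb
  · have h₁ : μ.real (Ioi a ×ˢ Iio b₁) ≤ μ.real (Ioi a ×ˢ Iio b₂) :=
      measureReal_mono (prod_mono subset_rfl (Iio_subset_Iio hb))
    rw [h.real_Ioi_prod_Iio, h.real_Ioi_prod_Iio] at h₁
    linarith [(le_abs_self _).trans (abs_clamp_sub_le b₂ b₁), abs_of_nonneg (sub_nonneg.2 hb),
      le_max_left (b₂ - b₁) 0]
  · linarith [h.upperLeft_antitone a hb, le_max_right (b₂ - b₁) 0]

lemma upperLeft_graph (h : IsPermuton μ) (hr : r ∈ Icc (0 : ℝ) 1) :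
    upperLeft μ (r + excursionHeight μ r) (r - excursionHeight μ r) = 2 * excursionHeight μ r := by
  have h₀ := excursionHeight_nonneg μ r
  have h₁ := h.excursionHeight_le_self hr.1
  have h₂ := h.excursionHeight_le_one_sub hr.2
  have h₃ := h.real_Ioi_prod_Iio (r + excursionHeight μ r) (r - excursionHeight μ r)
  rw [measureReal_def, h.Ioi_prod_Iio_null, ENNReal.toReal_zero,
    clamp_of_mem ⟨by linarith, by linarith⟩, clamp_of_mem ⟨by linarith, by linarith⟩] at h₃
  linarith

lemma upperLeft_le_ulMass (h : IsPermuton μ) (a b : ℝ) :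
    upperLeft μ a b ≤ ulMass (excursionHeight μ) a b := by
  obtain ⟨r, hr, he⟩ := IsExcursion.exists_ulMass_eq h.excursion a b
  change ulMass (excursionHeight μ) a b = ulCost (excursionHeight μ) a b r at he
  rw [he, ulCost, ← h.upperLeft_graph hr]
  linarith [h.upperLeft_le_add_left (r + excursionHeight μ r) a b,
    h.upperLeft_le_add_right (r + excursionHeight μ r) b (r - excursionHeight μ r)]

/-- The masses that a `231`-avoiding permuton gives to quadrants can be read off its excursion. -/
theorem upperLeft_eq_ulMass (h : IsPermuton μ) (hμ : PermutonAvoids231 μ)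
    (ha : a ∈ Icc (0 : ℝ) 1) (hb : b ∈ Icc (0 : ℝ) 1) :
    upperLeft μ a b = ulMass (excursionHeight μ) a b := by
  have := h.1
  refine (h.upperLeft_le_ulMass a b).antisymm ?_
  by_contra! hlt
  have hφ := h.isExcursion_excursion
  have hcost {r : ℝ} (hr : r ∈ Icc (0 : ℝ) 1) :
      upperLeft μ a b < ulCost (excursionHeight μ) a b r := hlt.trans_le (hφ.ulMass_le a b hr)
  -- the lowest level at which the mass to the left of `a` is the same as at level `b`
  have hcl : IsCompact (Icc 0 b ∩ {y | upperLeft μ a y ≤ upperLeft μ a b}) :=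
    isCompact_Icc.inter_right (isClosed_le (h.continuous_upperLeft a) continuous_const)
  obtain ⟨y, ⟨⟨hy₀, hyb⟩, hy⟩, hleast⟩ := hcl.exists_isLeast ⟨b, ⟨hb.1, le_rfl⟩, le_refl (upperLeft μ a b)⟩
  rw [mem_ofPred_eq] at hy
  have hy_pos : 0 < y := by
    refine hy₀.lt_of_ne fun h0 ↦ ?_
    have h₁ := hcost (r := 0) ⟨le_rfl, zero_le_one⟩
    rw [← h0, h.upperLeft_zero_right ha] at hy
    rw [ulCost, h.excursionHeight_of_nonpos le_rfl] at h₁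
    simp only [add_zero, sub_zero, mul_zero, zero_sub] at h₁
    rw [max_eq_left ha.1, max_eq_right (by linarith [hb.1])] at h₁
    linarith
  -- the first point of the excursion graph at this level
  have hcont : Continuous fun r ↦ r - excursionHeight μ r :=
    continuous_id.sub h.lipschitzWith_excursionHeight.continuous
  obtain ⟨r, ⟨hr, hry⟩, hr_least⟩ :
      ∃ r, IsLeast (Icc 0 1 ∩ {r | r - excursionHeight μ r = y}) r := by
    refine (isCompact_Icc.inter_right (isClosed_eq hcont continuous_const)).exists_isLeast ?_
    obtain ⟨r, hr, he⟩ := intermediate_value_Icc zero_le_one hcont.continuousOn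
      (show y ∈ Icc _ _ from ⟨by simp [h.excursionHeight_of_nonpos le_rfl, hy₀],
        by simpa [h.excursionHeight_of_one_le le_rfl] using hyb.trans hb.2⟩)
    exact ⟨r, hr, he⟩
  rw [mem_ofPred_eq] at hry
  have hr_lt {s : ℝ} (hs : 0 ≤ s) (hsr : s < r) : s - excursionHeight μ s < y := by
    refine lt_of_le_of_ne (hry ▸ hφ.monotone_sub hsr.le) fun he ↦ ?_
    exact absurd (hr_least ⟨⟨hs, hsr.le.trans hr.2⟩, he⟩) (not_le.2 hsr)
  have hx₁ := h.excursionHeight_le_one_sub hr.2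
  have hxcost := hcost hr
  rw [ulCost, hry, max_eq_right (sub_nonpos.2 hyb), add_zero] at hxcost
  have hy₁ : y ∈ Icc (0 : ℝ) 1 := ⟨hy₀, hyb.trans hb.2⟩
  rcases le_or_gt (r + excursionHeight μ r) a with hxa | hax
  · rw [max_eq_left (sub_nonneg.2 hxa)] at hxcost
    have h₁ := h.real_Ioi_prod_Iio a y
    rw [clamp_of_mem ha, clamp_of_mem hy₁] at h₁
    linarith [measureReal_nonneg (μ := μ) (s := Ioi a ×ˢ Iio y)]
  rw [max_eq_right (sub_nonpos.2 hax.le), zero_add, ← h.upperLeft_graph hr, hry] at hxcost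
  obtain ⟨x, hax', hxr, hxB⟩ : ∃ x, a < x ∧ x < r + excursionHeight μ r ∧
      upperLeft μ a y < upperLeft μ x y := by
    set X := r + excursionHeight μ r
    set g := upperLeft μ X y - upperLeft μ a y
    have hg : 0 < g := by grind
    refine ⟨max ((a + X) / 2) (X - g / 2), lt_max_of_lt_left (by linarith),
      max_lt (by linarith) (by linarith), ?_⟩
    have h₁ := h.upperLeft_le_add_left (max ((a + X) / 2) (X - g / 2)) X y
    grind
  have hx : x ∈ Icc (0 : ℝ) 1 := ⟨ha.1.trans hax'.le, by linarith⟩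
  have hC : 0 < μ.real (Ioi x ×ˢ Iio y) := by
    refine measureReal_nonneg.lt_of_ne fun h0 ↦ ?_
    have h₁ := h.real_Ioi_prod_Iio x y
    rw [← h0, clamp_of_mem hx, clamp_of_mem hy₁] at h₁
    have hyx : y ≤ x := by linarith [upperLeft_nonneg μ x y]
    have h₂ : excursionHeight μ ((x + y) / 2) ≤ (x - y) / 2 := by
      refine excursionHeight_le (by linarith) ?_
      rw [show (x + y) / 2 + (x - y) / 2 = x by ring, show (x + y) / 2 - (x - y) / 2 = y by ring]
      exact (measureReal_eq_zero_iff).1 h0.symm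
    have h₃ : (x + y) / 2 < r := by
      by_contra! h₃
      have : r + excursionHeight μ r ≤ (x + y) / 2 + excursionHeight μ ((x + y) / 2) :=
        hφ.monotone_add h₃
      linarith
    linarith [hr_lt (by linarith [hx.1]) h₃]
  rw [h.real_Ioi_prod_Iio, clamp_of_mem hx, clamp_of_mem hy₁] at hC
  obtain ⟨z, hz₀, hzy, hzC⟩ : ∃ z, 0 ≤ z ∧ z < y ∧ 0 < μ.real (Ioi x ×ˢ Iio z) := by
    set m := y - x + upperLeft μ x y
    have hz : max 0 (y - m / 2) < y := max_lt hy_pos (by linarith)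
    refine ⟨max 0 (y - m / 2), le_max_left _ _, hz, ?_⟩
    rw [h.real_Ioi_prod_Iio, clamp_of_mem hx, clamp_of_mem ⟨le_max_left _ _, hz.le.trans hy₁.2⟩]
    have h₁ := h.upperLeft_antitone x hz.le
    linarith [le_max_right 0 (y - m / 2)]
  have hzA : upperLeft μ a b < upperLeft μ a z := by
    by_contra! hzA
    exact absurd (hleast ⟨⟨hz₀, hzy.le.trans hyb⟩, hzA⟩) (not_le.2 hzy)
  have hA := h.real_Iic_prod_Ico a hzy.le
  have hB := h.real_Ioc_prod_Ici hax'.le y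
  rcases hμ.null_of_forall (A := Iic a ×ˢ Ico z y) (B := Ioc a x ×ˢ Ici y)
    (C := Ioi x ×ˢ Iio z) fun p hp q hq r hr ↦ ⟨hp.1.trans_lt hq.1.1, hq.1.2.trans_lt hr.1,
      hr.2.trans_le hp.2.1, hp.2.2.trans_le hq.2⟩ with h0 | h0 | h0
  · rw [measureReal_def, h0, ENNReal.toReal_zero] at hA
    linarith
  · rw [measureReal_def, h0, ENNReal.toReal_zero] at hB
    linarith
  · rw [measureReal_def, h0, ENNReal.toReal_zero] at hzC
    exact hzC.false

end IsPermuton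

/-! ### The permuton associated with an excursion -/

namespace IsExcursion

variable {φ : BoundedContinuousFunction ℝ ℝ}

/-- The distribution function of the permuton associated with an excursion. -/
def cdf (φ : ℝ → ℝ) (a b : ℝ) : ℝ := clamp a - ulMass φ (clamp a) (clamp b)

lemma cdf_one_right (h : IsExcursion φ) (a : ℝ) : cdf φ a 1 = clamp a := by
  rw [cdf, clamp_of_one_le le_rfl, h.ulMass_one_right (clamp_mem a).2, sub_zero]

lemma cdf_one_left (h : IsExcursion φ) (b : ℝ) : cdf φ 1 b = clamp b := by
  rw [cdf, clamp_of_one_le le_rfl, h.ulMass_one_left (clamp_mem b).2, sub_sub_cancel]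

lemma isLipschitzCDF (h : IsExcursion φ) : IsLipschitzCDF (cdf φ) where
  rect_nonneg a₁ a₂ b₁ b₂ ha hb := by
    have := h.ulMass_add_ulMass_le (clamp_mono ha) (clamp_mono hb)
    unfold cdf
    linarith
  abs_sub_left_le a a' b := by
    have key {a a' : ℝ} (haa : a ≤ a') : |cdf φ a b - cdf φ a' b| ≤ |a - a'| := by
      have h₁ := h.ulMass_add_ulMass_le (clamp_mono haa) (clamp_mem b).2
      rw [h.ulMass_one_right (clamp_mem a).2, h.ulMass_one_right (clamp_mem a').2] at h₁
      have h₂ := h.ulMass_le_add_left (a₁ := clamp a) (a₂ := clamp a') (clamp b)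
      have h₃ := abs_clamp_sub_le a a'
      have h₄ := clamp_mono haa
      rw [max_eq_left (sub_nonneg.2 h₄)] at h₂
      rw [abs_of_nonpos (sub_nonpos.2 h₄)] at h₃
      unfold cdf
      rw [abs_le]
      constructor <;> linarith
    rcases le_total a a' with haa | haa
    · exact key haa
    · rw [abs_sub_comm, abs_sub_comm a]; exact key haa
  abs_sub_right_le a b b' := by
    have key {b b' : ℝ} (hbb : b ≤ b') : |cdf φ a b - cdf φ a b'| ≤ |b - b'| := by
      have h₁ := h.ulMass_add_ulMass_le (clamp_mem a).1 (clamp_mono hbb)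
      rw [h.ulMass_zero_left (clamp_mem b).1, h.ulMass_zero_left (clamp_mem b').1] at h₁
      have h₂ := h.ulMass_le_add_right (clamp a) (b₁ := clamp b) (b₂ := clamp b')
      have h₃ := abs_clamp_sub_le b b'
      have h₄ := clamp_mono hbb
      rw [max_eq_left (sub_nonneg.2 h₄)] at h₂
      rw [abs_of_nonpos (sub_nonpos.2 h₄)] at h₃
      unfold cdf
      rw [abs_le]
      constructor <;> linarith
    rcases le_total b b' with hbb | hbb
    · exact key hbb
    · rw [abs_sub_comm, abs_sub_comm b]; exact key hbb
  eq_zero_left a ha b := by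
    rw [cdf, clamp_of_nonpos ha, h.ulMass_zero_left (clamp_mem b).1, sub_zero]
  eq_zero_right a b hb := by
    rw [cdf, clamp_of_nonpos hb, h.ulMass_zero_right (clamp_mem a).1, sub_self]
  eq_one_left a ha b := by rw [cdf, cdf, clamp_of_one_le ha, clamp_of_one_le le_rfl]
  eq_one_right a b hb := by rw [cdf, cdf, clamp_of_one_le hb, clamp_of_one_le le_rfl]
  one_one := by rw [h.cdf_one_right, clamp_of_one_le le_rfl]

/-- The permuton associated with an excursion. -/
def permuton (h : IsExcursion φ) : ProbabilityMeasure (ℝ × ℝ) :=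
  h.isLipschitzCDF.exists_probabilityMeasure.choose

lemma permuton_Iic_prod_Iic (h : IsExcursion φ) (a b : ℝ) :
    (h.permuton : Measure (ℝ × ℝ)) (Iic a ×ˢ Iic b) = ENNReal.ofReal (cdf φ a b) :=
  h.isLipschitzCDF.exists_probabilityMeasure.choose_spec a b

lemma permuton_ae_le_one (h : IsExcursion φ) :
    ∀ᵐ p ∂(h.permuton : Measure (ℝ × ℝ)), p.1 ≤ 1 ∧ p.2 ≤ 1 := by
  have h₁ : (h.permuton : Measure (ℝ × ℝ)) (Iic 1 ×ˢ Iic 1) = 1 := by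
    rw [h.permuton_Iic_prod_Iic, h.isLipschitzCDF.one_one, ENNReal.ofReal_one]
  exact (prob_compl_eq_zero_iff (measurableSet_Iic.prod measurableSet_Iic)).2 h₁

lemma restrict_Icc_Iic (a : ℝ) :
    (volume.restrict (Icc (0 : ℝ) 1)) (Iic a) = ENNReal.ofReal (clamp a) := by
  rw [← IsPermuton.volume_real_Iic, ofReal_measureReal]

lemma isPermuton_permuton (h : IsExcursion φ) :
    IsPermuton (h.permuton : Measure (ℝ × ℝ)) := by
  refine ⟨inferInstance, ?_, ?_⟩
  · have := Measure.isProbabilityMeasure_map (μ := (h.permuton : Measure (ℝ × ℝ)))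
      measurable_fst.aemeasurable
    refine Measure.ext_of_Iic _ _ fun a ↦ ?_
    rw [Measure.map_apply measurable_fst measurableSet_Iic, restrict_Icc_Iic, ← h.cdf_one_right,
      ← h.permuton_Iic_prod_Iic]
    refine measure_congr ?_
    filter_upwards [h.permuton_ae_le_one] with p hp
    exact propext ⟨fun hp' ↦ ⟨hp', hp.2⟩, fun hp' ↦ hp'.1⟩
  · have := Measure.isProbabilityMeasure_map (μ := (h.permuton : Measure (ℝ × ℝ)))
      measurable_snd.aemeasurable
    refine Measure.ext_of_Iic _ _ fun b ↦ ?_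
    rw [Measure.map_apply measurable_snd measurableSet_Iic, restrict_Icc_Iic, ← h.cdf_one_left,
      ← h.permuton_Iic_prod_Iic]
    refine measure_congr ?_
    filter_upwards [h.permuton_ae_le_one] with p hp
    exact propext ⟨fun hp' ↦ ⟨hp.1, hp'⟩, fun hp' ↦ hp'.2⟩

lemma upperLeft_permuton (h : IsExcursion φ) (a b : ℝ) :
    upperLeft h.permuton a b = ulMass φ (clamp a) (clamp b) := by
  have h₁ := h.isPermuton_permuton.real_Iic_prod_Iio a b
  have h₂ : (h.permuton : Measure (ℝ × ℝ)).real (Iic a ×ˢ Iio b) =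
      (h.permuton : Measure (ℝ × ℝ)).real (Iic a ×ˢ Iic b) := by
    refine measureReal_congr ?_
    filter_upwards [h.isPermuton_permuton.ae_snd_ne b] with p hp
    exact propext (and_congr_right fun _ ↦ ⟨fun hb ↦ (mem_Iio.1 hb).le, fun hb ↦ lt_of_le_of_ne hb hp⟩)
  have h₃ : 0 ≤ cdf φ a b := by
    have h₁ := h.isLipschitzCDF.rect_nonneg (min_le_right 0 a) (min_le_right 0 b)
    rw [h.isLipschitzCDF.eq_zero_left _ (min_le_left 0 a),
      h.isLipschitzCDF.eq_zero_left _ (min_le_left 0 a),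
      h.isLipschitzCDF.eq_zero_right _ _ (min_le_left 0 b)] at h₁
    linarith
  rw [h₂, measureReal_def, h.permuton_Iic_prod_Iic, ENNReal.toReal_ofReal h₃, cdf] at h₁
  linarith

lemma avoids231_permuton (h : IsExcursion φ) :
    PermutonAvoids231 (h.permuton : Measure (ℝ × ℝ)) := by
  have hP := h.isPermuton_permuton
  set μ : Measure (ℝ × ℝ) := ↑h.permuton with hμ
  have key (q₁ q₂ w₁ w₂ : ℚ) : (μ.prod (μ.prod μ))
      ((Iic (q₁ : ℝ) ×ˢ Ico (w₁ : ℝ) w₂) ×ˢ ((Ioc (q₁ : ℝ) q₂ ×ˢ Ici (w₂ : ℝ)) ×ˢ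
        (Ioi (q₂ : ℝ) ×ˢ Iio (w₁ : ℝ)))) = 0 := by
    rcases lt_or_ge q₂ q₁ with hq | hq
    · rw [Ioc_eq_empty (by exact_mod_cast hq.not_gt)]; simp
    rcases lt_or_ge w₂ w₁ with hw | hw
    · rw [Ico_eq_empty (by exact_mod_cast hw.not_gt)]; simp
    have hA := hP.real_Iic_prod_Ico q₁ (b₁ := w₁) (b₂ := w₂) (by exact_mod_cast hw)
    have hB := hP.real_Ioc_prod_Ici (a₁ := q₁) (a₂ := q₂) (by exact_mod_cast hq) w₂
    have hC := hP.real_Ioi_prod_Iio q₂ w₁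
    simp only [hμ, h.upperLeft_permuton] at hA hB hC
    rw [Measure.prod_prod, Measure.prod_prod, mul_eq_zero, mul_eq_zero]
    by_contra! hne
    obtain ⟨hA', hB', hC'⟩ := hne
    have hpos {s : Set (ℝ × ℝ)} (hs : μ s ≠ 0) : 0 < μ.real s :=
      ENNReal.toReal_pos hs (measure_ne_top _ _)
    have hA₁ := hpos hA'
    have hB₁ := hpos hB'
    have hC₁ := hpos hC'
    exact h.ulMass_not_231 (a₁ := clamp q₁) (a₂ := clamp q₂) (b₁ := clamp w₁) (b₂ := clamp w₂)
      (by linarith) (by linarith) (by linarith)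
  refine measure_mono_null (t := ⋃ (q₁ : ℚ) (q₂ : ℚ) (w₁ : ℚ) (w₂ : ℚ),
      (Iic (q₁ : ℝ) ×ˢ Ico (w₁ : ℝ) w₂) ×ˢ ((Ioc (q₁ : ℝ) q₂ ×ˢ Ici (w₂ : ℝ)) ×ˢ
        (Ioi (q₂ : ℝ) ×ˢ Iio (w₁ : ℝ)))) ?_ ?_
  · rintro ⟨p, q, r⟩ ⟨h₁, h₂, h₃, h₄⟩
    obtain ⟨q₁, hq₁, hq₁'⟩ := exists_rat_btwn h₁
    obtain ⟨q₂, hq₂, hq₂'⟩ := exists_rat_btwn h₂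
    obtain ⟨w₁, hw₁, hw₁'⟩ := exists_rat_btwn h₃
    obtain ⟨w₂, hw₂, hw₂'⟩ := exists_rat_btwn h₄
    simp only [mem_iUnion]
    exact ⟨q₁, q₂, w₁, w₂, ⟨hq₁.le, hw₁'.le, hw₂⟩, ⟨⟨hq₁', hq₂.le⟩, hw₂'.le⟩, hq₂', hw₁⟩
  · exact measure_iUnion_null fun q₁ ↦ measure_iUnion_null fun q₂ ↦
      measure_iUnion_null fun w₁ ↦ measure_iUnion_null fun w₂ ↦ key q₁ q₂ w₁ w₂

lemma excursionHeight_permuton (h : IsExcursion φ) (t : ℝ) :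
    excursionHeight h.permuton t = φ t := by
  have hP := h.isPermuton_permuton
  by_cases ht : t ∈ Icc (0 : ℝ) 1
  swap
  · rw [h.2.2.2.2 t ht]
    exact hP.isExcursion_excursion.2.2.2.2 t ht
  have h₀ : 0 ≤ φ t := h.2.1 t
  have h₁ : 0 ≤ t - φ t := by simpa [h.2.2.1] using h.monotone_sub ht.1
  have h₂ : t + φ t ≤ 1 := by simpa [h.2.2.2.1] using h.monotone_add ht.2
  have hmass {u : ℝ} (hu₀ : 0 ≤ u) (hu : u ≤ φ t) :
      (h.permuton : Measure (ℝ × ℝ)).real (Ioi (t + u) ×ˢ Iio (t - u)) =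
        ulMass φ (t + u) (t - u) - 2 * u := by
    rw [hP.real_Ioi_prod_Iio, h.upperLeft_permuton, clamp_of_mem ⟨by linarith, by linarith⟩,
      clamp_of_mem ⟨by linarith, by linarith⟩]
    ring
  refine le_antisymm (IsPermuton.excursionHeight_le h₀ ?_) ?_
  · refine (measureReal_eq_zero_iff).1 (le_antisymm ?_ measureReal_nonneg)
    rw [hmass h₀ le_rfl]
    linarith [h.ulMass_graph_le ht]
  · by_contra! hlt
    have h₃ := hmass (excursionHeight_nonneg _ t) hlt.le
    rw [measureReal_def, hP.Ioi_prod_Iio_null, ENNReal.toReal_zero] at h₃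
    linarith [h.lt_ulMass hlt]

end IsExcursion

/-! ### Compactness of the space of excursions and the homeomorphism -/

open BoundedContinuousFunction in
/-- The set of excursions is compact. -/
theorem isCompact_setOf_isExcursion : IsCompact {φ : ℝ →ᵇ ℝ | IsExcursion φ} := by
  let z : Icc (0 : ℝ) 1 := ⟨0, le_rfl, zero_le_one⟩
  let o : Icc (0 : ℝ) 1 := ⟨1, zero_le_one, le_rfl⟩
  let A : Set (Icc (0 : ℝ) 1 →ᵇ ℝ) :=
    (⋂ (x) (y), {g | dist (g x) (g y) ≤ dist x y}) ∩ (⋂ x, {g | g x ∈ Icc (0 : ℝ) 1}) ∩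
      ({g | g z = 0} ∩ {g | g o = 0})
  have mem_A (g : Icc (0 : ℝ) 1 →ᵇ ℝ) : g ∈ A ↔ ((∀ x y, dist (g x) (g y) ≤ dist x y) ∧
      ∀ x, g x ∈ Icc (0 : ℝ) 1) ∧ g z = 0 ∧ g o = 0 := by
    simp only [A, mem_inter_iff, mem_iInter, mem_ofPred_eq]
  have hev (x : Icc (0 : ℝ) 1) : Continuous fun g : Icc (0 : ℝ) 1 →ᵇ ℝ ↦ g x :=
    continuous_eval_const x
  have hA : IsClosed A := by
    refine IsClosed.inter (IsClosed.inter ?_ ?_) (IsClosed.inter ?_ ?_)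
    · exact isClosed_iInter fun x ↦ isClosed_iInter fun y ↦
        isClosed_le ((hev x).dist (hev y)) continuous_const
    · exact isClosed_iInter fun x ↦ isClosed_Icc.preimage (hev x)
    · exact isClosed_eq (hev z) continuous_const
    · exact isClosed_eq (hev o) continuous_const
  have hA' : IsCompact A := by
    refine arzela_ascoli₂ (Icc 0 1) isCompact_Icc A hA
      (fun f x hf ↦ ((mem_A f).1 hf).1.2 x) ?_
    exact Metric.equicontinuous_of_continuity_modulus id tendsto_id _
      fun x y f ↦ ((mem_A f).1 f.2).1.1 x y
  let p : C(ℝ, Icc (0 : ℝ) 1) := ⟨projIcc 0 1 zero_le_one, continuous_projIcc⟩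
  have hp₀ {t : ℝ} (ht : t ≤ 0) : p t = z := projIcc_of_le_left zero_le_one ht
  have hp₁ {t : ℝ} (ht : 1 ≤ t) : p t = o := projIcc_of_right_le zero_le_one ht
  convert hA'.image (continuous_compContinuous p)
  ext φ
  constructor
  · intro (h : IsExcursion φ)
    refine ⟨φ.compContinuous ⟨Subtype.val, continuous_subtype_val⟩,
      (mem_A _).2 ⟨⟨fun x y ↦ ?_, fun x ↦ ?_⟩, h.2.2.1, h.2.2.2.1⟩, ?_⟩
    · exact h.abs_sub_le x y
    · have h₁ : (x : ℝ) + φ x ≤ 1 := by simpa [h.2.2.2.1] using h.monotone_add x.2.2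
      exact ⟨h.2.1 x, show φ x ≤ 1 by linarith [x.2.1]⟩
    · ext t
      change φ (p t) = φ t
      rcases le_total t 0 with ht | ht
      · rw [hp₀ ht]
        rcases ht.eq_or_lt with rfl | ht
        · rfl
        · rw [h.2.2.2.2 t fun h' ↦ absurd h'.1 (not_le.2 ht)]; exact h.2.2.1
      rcases le_total 1 t with ht' | ht'
      · rw [hp₁ ht']
        rcases ht'.eq_or_lt with rfl | ht'
        · rfl
        · rw [h.2.2.2.2 t fun h' ↦ absurd h'.2 (not_le.2 ht')]; exact h.2.2.2.1
      · rw [show p t = ⟨t, ht, ht'⟩ from projIcc_of_mem zero_le_one ⟨ht, ht'⟩]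
  · rintro ⟨g, hg, rfl⟩
    obtain ⟨⟨hg₁, hg₂⟩, hz, ho⟩ := (mem_A g).1 hg
    have hp : LipschitzWith 1 p := LipschitzWith.projIcc zero_le_one
    refine ⟨?_, fun t ↦ (hg₂ (p t)).1, ?_, ?_, fun t ht ↦ ?_⟩
    · refine LipschitzWith.of_dist_le_mul fun s t ↦ (hg₁ _ _).trans (hp.dist_le_mul s t)
    · change g (p 0) = 0
      rw [hp₀ le_rfl, hz]
    · change g (p 1) = 0
      rw [hp₁ le_rfl, ho]
    · change g (p t) = 0
      rcases le_total t 0 with h₀ | h₀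
      · rw [hp₀ h₀, hz]
      rcases le_total 1 t with h₁ | h₁
      · rw [hp₁ h₁, ho]
      · exact absurd ⟨h₀, h₁⟩ ht

instance : CompactSpace Espace :=
  isCompact_iff_compactSpace.1 isCompact_setOf_isExcursion

instance : T2Space Permutons231 :=
  inferInstanceAs (T2Space {μ : ProbabilityMeasure (ℝ × ℝ) //
    IsPermuton (μ : Measure (ℝ × ℝ)) ∧ PermutonAvoids231 (μ : Measure (ℝ × ℝ))})

/-- The bijection between excursions and `231`-avoiding permutons. -/
def excursionEquiv : Espace ≃ Permutons231 where
  toFun φ := ⟨φ.2.permuton, φ.2.isPermuton_permuton, φ.2.avoids231_permuton⟩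
  invFun μ := ⟨μ.2.1.excursion, μ.2.1.isExcursion_excursion⟩
  left_inv φ := Subtype.ext <| BoundedContinuousFunction.ext fun t ↦
    φ.2.excursionHeight_permuton t
  right_inv μ := by
    refine Subtype.ext ?_
    have hE := μ.2.1.isExcursion_excursion
    refine tendsto_nhds_unique (f := fun _ : ℕ ↦ hE.permuton) (l := atTop) tendsto_const_nhds
      (IsPermuton.tendsto_of_upperLeft (fun _ ↦ hE.isPermuton_permuton) μ.2.1 fun a ha b hb ↦ ?_)
    rw [hE.upperLeft_permuton, clamp_of_mem ha, clamp_of_mem hb,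
      μ.2.1.upperLeft_eq_ulMass μ.2.2 ha hb]
    exact tendsto_const_nhds

lemma continuous_excursionEquiv : Continuous excursionEquiv := by
  refine Continuous.subtype_mk (f := fun φ : {φ // IsExcursion φ} ↦ φ.2.permuton) ?_ _
  refine continuous_iff_continuousAt.2 fun ψ ↦ IsPermuton.tendsto_of_upperLeft
    (fun φ ↦ φ.2.isPermuton_permuton) ψ.2.isPermuton_permuton fun a _ b _ ↦ ?_
  simp only [IsExcursion.upperLeft_permuton]
  have hd : Tendsto (fun φ : {φ // IsExcursion φ} ↦ 4 * dist φ.1 ψ.1) (𝓝 ψ) (𝓝 0) := by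
    have : Continuous fun φ : {φ // IsExcursion φ} ↦ 4 * dist φ.1 ψ.1 := by fun_prop
    simpa using this.tendsto ψ
  refine tendsto_iff_dist_tendsto_zero.2 (squeeze_zero (fun _ ↦ dist_nonneg) (fun φ ↦ ?_) hd)
  have h₁ := φ.2.ulMass_le_add_dist (ψ := ψ.1) (clamp a) (clamp b)
  have h₂ := ψ.2.ulMass_le_add_dist (ψ := φ.1) (clamp a) (clamp b)
  rw [dist_comm] at h₂
  rw [Real.dist_eq, abs_le]
  constructor <;> linarith

/-- The map sending a `231`-avoiding permuton to the excursion associated with its RLM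
curve is a homeomorphism onto `E`; in particular it is a bijection, and both it and its
inverse are continuous. -/
theorem permuton231_excursion_homeomorph :
    ∃ Φ : Permutons231 ≃ₜ Espace,
      ∀ μ : Permutons231,
        completedGraph (RLMcurve (μ.1 : Measure (ℝ × ℝ))) =
          excursionGraph ⇑(Φ μ).1 := by
  exact ⟨(continuous_excursionEquiv.homeoOfEquivCompactToT2).symm,
    fun μ ↦ μ.2.1.completedGraph_RLMcurve⟩

end
end

section
/- Let μ be a 321-avoiding permuton, and write μ_lr, μ_ul, μ_diag for its restrictions to {(x,y) ∈ [0,1]²: x>y}, {(x,y): x<y} and {(x,y): x=y} respectively. Then the topological support of μ_lr + μ_diag is a nondecreasing subset of [0,1]², i.e. any two points (x₁,y₁), (x₂,y₂) in it satisfy (x₁−x₂)(y₁−y₂) ≥ 0; and the same holds for the support of μ_ul + μ_diag. -/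
open MeasureTheory Filter Set

noncomputable section

/-- A permuton avoids the pattern `321` if `μ⊗μ⊗μ` gives zero mass to triples of
points in relative position `321`. -/
def PermutonAvoids321 (μ : Measure (ℝ × ℝ)) : Prop :=
  (μ.prod (μ.prod μ))
    {t : (ℝ × ℝ) × (ℝ × ℝ) × (ℝ × ℝ) |
      t.1.1 < t.2.1.1 ∧ t.2.1.1 < t.2.2.1 ∧ t.2.2.2 < t.2.1.2 ∧ t.2.1.2 < t.1.2} = 0

/-- The topological support of a measure. -/
def msupport (μ : Measure (ℝ × ℝ)) : Set (ℝ × ℝ) :=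
  {z : ℝ × ℝ | ∀ U : Set (ℝ × ℝ), IsOpen U → z ∈ U → 0 < μ U}

/-- Every neighbourhood of a point in the support of a sum of two restrictions of `μ` is charged
by `μ`. -/
theorem measure_pos_of_mem_msupport_restrict_add {μ : Measure (ℝ × ℝ)} {S T : Set (ℝ × ℝ)}
    {z : ℝ × ℝ} (hz : z ∈ msupport (μ.restrict S + μ.restrict T)) (U : Set (ℝ × ℝ))
    (hU : IsOpen U) (hzU : z ∈ U) : 0 < μ U := by
  have h := hz U hU hzU
  contrapose! h
  have h0 : μ U = 0 := le_antisymm h bot_le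
  simp [Measure.restrict_apply hU.measurableSet, measure_mono_null inter_subset_left h0]

theorem snd_le_fst_of_mem_msupport {μ : Measure (ℝ × ℝ)} {z : ℝ × ℝ}
    (hz : z ∈ msupport (μ.restrict {p : ℝ × ℝ | p.2 < p.1} +
      μ.restrict {p : ℝ × ℝ | p.1 = p.2})) : z.2 ≤ z.1 := by
  by_contra! h
  have hU : IsOpen {p : ℝ × ℝ | p.1 < p.2} := isOpen_lt continuous_fst continuous_snd
  have h₁ : {p : ℝ × ℝ | p.1 < p.2} ∩ {p | p.2 < p.1} = ∅ := by
    ext p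
    simpa using le_of_lt
  have h₂ : {p : ℝ × ℝ | p.1 < p.2} ∩ {p | p.1 = p.2} = ∅ := by
    ext p
    simpa using ne_of_lt
  simpa [Measure.restrict_apply hU.measurableSet, h₁, h₂] using hz _ hU h

theorem fst_le_snd_of_mem_msupport {μ : Measure (ℝ × ℝ)} {z : ℝ × ℝ}
    (hz : z ∈ msupport (μ.restrict {p : ℝ × ℝ | p.1 < p.2} +
      μ.restrict {p : ℝ × ℝ | p.1 = p.2})) : z.1 ≤ z.2 := by
  by_contra! h
  have hU : IsOpen {p : ℝ × ℝ | p.2 < p.1} := isOpen_lt continuous_snd continuous_fst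
  have h₁ : {p : ℝ × ℝ | p.2 < p.1} ∩ {p | p.1 < p.2} = ∅ := by
    ext p
    simpa using le_of_lt
  have h₂ : {p : ℝ × ℝ | p.2 < p.1} ∩ {p | p.1 = p.2} = ∅ := by
    ext p
    simpa using ne_of_gt
  simpa [Measure.restrict_apply hU.measurableSet, h₁, h₂] using hz _ hU h

/-- If `f` and `g` are both uniform on `[0,1]`, then the mass of `{s ≤ f, g ≤ t}` exceeds the mass
of `{f < s, t < g}` by at most `t - s`. -/
theorem measure_le_measure_opposite_quadrant_add {Ω : Type*} [MeasurableSpace Ω] {μ : Measure Ω}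
    [IsFiniteMeasure μ] {f g : Ω → ℝ} (hf : Measurable f) (hg : Measurable g)
    (hf' : μ.map f = volume.restrict (Icc (0 : ℝ) 1))
    (hg' : μ.map g = volume.restrict (Icc (0 : ℝ) 1)) (s t : ℝ) :
    μ {p | s ≤ f p ∧ g p ≤ t} ≤ μ {p | f p < s ∧ t < g p} + ENNReal.ofReal (t - s) := by
  set E := f ⁻¹' Iio s with hE
  set F := g ⁻¹' Iic t with hF
  have hEm : MeasurableSet E := hf measurableSet_Iio
  have hFm : MeasurableSet F := hg measurableSet_Iic
  have hFE : {p | s ≤ f p ∧ g p ≤ t} = F \ E := by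
    ext p
    simp [hE, hF, and_comm]
  have hEF : {p | f p < s ∧ t < g p} = E \ F := by
    ext p
    simp [hE, hF]
  have hμF : μ F ≤ μ E + ENNReal.ofReal (t - s) := by
    rw [hE, hF, ← Measure.map_apply hf measurableSet_Iio, ← Measure.map_apply hg measurableSet_Iic,
      hf', hg']
    calc volume.restrict (Icc (0 : ℝ) 1) (Iic t)
        ≤ volume.restrict (Icc (0 : ℝ) 1) (Iio s ∪ Icc s t) := by
          refine measure_mono fun x hx => ?_
          rcases lt_or_ge x s with h | h
          exacts [Or.inl h, Or.inr ⟨h, hx⟩]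
      _ ≤ _ := (measure_union_le _ _).trans
          (add_le_add_right ((Measure.restrict_apply_le _ _).trans_eq Real.volume_Icc) _)
  rw [hFE, hEF]
  have h : μ E + μ (F \ E) ≤ μ E + (μ (E \ F) + ENNReal.ofReal (t - s)) :=
    calc μ E + μ (F \ E) = μ (E \ F) + μ F := by
          rw [measure_add_sdiff hEm.nullMeasurableSet, add_comm,
            measure_add_sdiff hFm.nullMeasurableSet, union_comm]
      _ ≤ μ (E \ F) + (μ E + ENNReal.ofReal (t - s)) := by gcongr
      _ = _ := by ring
  exact (ENNReal.add_le_add_iff_left (measure_ne_top μ E)).1 h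

/-- Three sets in relative position `321` cannot all be charged by a `321`-avoiding measure. -/
theorem PermutonAvoids321.false_of_pos {μ : Measure (ℝ × ℝ)} [SFinite μ]
    (h : PermutonAvoids321 μ) {A B C : Set (ℝ × ℝ)} (hA : 0 < μ A) (hB : 0 < μ B) (hC : 0 < μ C)
    (hAB : ∀ p ∈ A, ∀ q ∈ B, p.1 < q.1 ∧ q.2 < p.2)
    (hBC : ∀ p ∈ B, ∀ q ∈ C, p.1 < q.1 ∧ q.2 < p.2) : False := by
  have h0 : (μ.prod (μ.prod μ)) (A ×ˢ B ×ˢ C) = 0 := by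
    refine measure_mono_null ?_ h
    rintro ⟨p, q, r⟩ ⟨hp, hq, hr⟩
    exact ⟨(hAB p hp q hq).1, (hBC q hq r hr).1, (hBC q hq r hr).2, (hAB p hp q hq).2⟩
  rw [Measure.prod_prod, Measure.prod_prod] at h0
  exact (ENNReal.mul_pos hA.ne' (ENNReal.mul_pos hB.ne' hC.ne').ne').ne' h0

theorem exists_pos_le_ofReal_two_mul_lt {m : ENNReal} (hm : 0 < m) {δ : ℝ} (hδ : 0 < δ) :
    ∃ ε : ℝ, 0 < ε ∧ ε ≤ δ ∧ ENNReal.ofReal (2 * ε) < m := by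
  obtain ⟨r, hr, hrm⟩ := ENNReal.lt_iff_exists_nnreal_btwn.1 hm
  have hr' : (0 : ℝ) < r := by exact_mod_cast hr
  refine ⟨min δ (r / 2), by positivity, min_le_left _ _, lt_of_le_of_lt ?_ hrm⟩
  rw [← ENNReal.ofReal_coe_nnreal]
  exact ENNReal.ofReal_le_ofReal (by linarith [min_le_right δ ((r : ℝ) / 2)])

theorem isOpen_box (a b ε : ℝ) :
    IsOpen {p : ℝ × ℝ | (a - ε < p.1 ∧ p.1 < a + ε) ∧ b - ε < p.2 ∧ p.2 < b + ε} :=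
  (isOpen_Ioo (a := a - ε) (b := a + ε)).prod (isOpen_Ioo (a := b - ε) (b := b + ε))

theorem no_descent_of_snd_le_fst {μ : Measure (ℝ × ℝ)} [IsFiniteMeasure μ]
    (hfst : μ.map Prod.fst = volume.restrict (Icc (0 : ℝ) 1))
    (hsnd : μ.map Prod.snd = volume.restrict (Icc (0 : ℝ) 1))
    (havoid : PermutonAvoids321 μ) {z w : ℝ × ℝ}
    (hz : ∀ U, IsOpen U → z ∈ U → 0 < μ U) (hw : ∀ U, IsOpen U → w ∈ U → 0 < μ U)
    (hle : z.2 ≤ z.1) (h₁ : z.1 < w.1) (h₂ : w.2 < z.2) : False := by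
  set W : Set (ℝ × ℝ) := Ioi ((z.1 + w.1) / 2) ×ˢ Iio ((z.2 + w.2) / 2) with hWdef
  have hW : 0 < μ W := hw W (isOpen_Ioi.prod isOpen_Iio)
    ⟨by simp only [mem_Ioi]; linarith, by simp only [mem_Iio]; linarith⟩
  obtain ⟨ε, hε, hεδ, hεW⟩ := exists_pos_le_ofReal_two_mul_lt hW
    (δ := min ((w.1 - z.1) / 2) ((z.2 - w.2) / 2)) (lt_min (by linarith) (by linarith))
  obtain ⟨hε₁, hε₂⟩ := le_min_iff.1 hεδ
  have hA : 0 < μ {p : ℝ × ℝ | p.1 < z.1 - ε ∧ z.2 + ε < p.2} := by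
    by_contra! h0
    refine hεW.not_ge ?_
    calc μ W ≤ μ {p : ℝ × ℝ | z.1 - ε ≤ p.1 ∧ p.2 ≤ z.2 + ε} := by
          refine measure_mono fun p hp => ?_
          simp only [hWdef, mem_prod, mem_Ioi, mem_Iio] at hp
          exact ⟨by linarith, by linarith⟩
      _ ≤ _ := measure_le_measure_opposite_quadrant_add measurable_fst measurable_snd hfst hsnd _ _
      _ ≤ 0 + ENNReal.ofReal (2 * ε) := by
          gcongr
          linarith
      _ = _ := zero_add _
  refine havoid.false_of_pos hA (hz _ (isOpen_box z.1 z.2 ε) ?_) hW ?_ ?_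
  · exact ⟨⟨by linarith, by linarith⟩, by linarith, by linarith⟩
  · rintro p ⟨_, _⟩ q ⟨⟨_, _⟩, _, _⟩
    exact ⟨by linarith, by linarith⟩
  · rintro p ⟨⟨_, _⟩, _, _⟩ q hq
    simp only [hWdef, mem_prod, mem_Ioi, mem_Iio] at hq
    exact ⟨by linarith, by linarith⟩

theorem no_descent_of_fst_le_snd {μ : Measure (ℝ × ℝ)} [IsFiniteMeasure μ]
    (hfst : μ.map Prod.fst = volume.restrict (Icc (0 : ℝ) 1))
    (hsnd : μ.map Prod.snd = volume.restrict (Icc (0 : ℝ) 1))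
    (havoid : PermutonAvoids321 μ) {z w : ℝ × ℝ}
    (hz : ∀ U, IsOpen U → z ∈ U → 0 < μ U) (hw : ∀ U, IsOpen U → w ∈ U → 0 < μ U)
    (hle : w.1 ≤ w.2) (h₁ : z.1 < w.1) (h₂ : w.2 < z.2) : False := by
  set Z : Set (ℝ × ℝ) := Iio ((z.1 + w.1) / 2) ×ˢ Ioi ((z.2 + w.2) / 2) with hZdef
  have hZ : 0 < μ Z := hz Z (isOpen_Iio.prod isOpen_Ioi)
    ⟨by simp only [mem_Iio]; linarith, by simp only [mem_Ioi]; linarith⟩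
  obtain ⟨ε, hε, hεδ, hεZ⟩ := exists_pos_le_ofReal_two_mul_lt hZ
    (δ := min ((w.1 - z.1) / 2) ((z.2 - w.2) / 2)) (lt_min (by linarith) (by linarith))
  obtain ⟨hε₁, hε₂⟩ := le_min_iff.1 hεδ
  have hA : 0 < μ {p : ℝ × ℝ | p.2 < w.2 - ε ∧ w.1 + ε < p.1} := by
    by_contra! h0
    refine hεZ.not_ge ?_
    calc μ Z ≤ μ {p : ℝ × ℝ | w.2 - ε ≤ p.2 ∧ p.1 ≤ w.1 + ε} := by
          refine measure_mono fun p hp => ?_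
          simp only [hZdef, mem_prod, mem_Ioi, mem_Iio] at hp
          exact ⟨by linarith, by linarith⟩
      _ ≤ _ := measure_le_measure_opposite_quadrant_add measurable_snd measurable_fst hsnd hfst _ _
      _ ≤ 0 + ENNReal.ofReal (2 * ε) := by
          gcongr
          linarith
      _ = _ := zero_add _
  refine havoid.false_of_pos hZ (hw _ (isOpen_box w.1 w.2 ε) ?_) hA ?_ ?_
  · exact ⟨⟨by linarith, by linarith⟩, by linarith, by linarith⟩
  · rintro p hp q ⟨⟨_, _⟩, _, _⟩
    simp only [hZdef, mem_prod, mem_Ioi, mem_Iio] at hp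
    exact ⟨by linarith, by linarith⟩
  · rintro p ⟨⟨_, _⟩, _, _⟩ q ⟨_, _⟩
    exact ⟨by linarith, by linarith⟩

/-- For a `321`-avoiding permuton, the supports of `μ_lr + μ_diag` and of
`μ_ul + μ_diag` are nondecreasing subsets of `[0,1]²`. -/
theorem support_lower_and_upper_parts_nondecreasing (μ : Measure (ℝ × ℝ))
    (hμ : IsPermuton μ) (havoid : PermutonAvoids321 μ) :
    (∀ z ∈ msupport (μ.restrict {p : ℝ × ℝ | p.2 < p.1} +
        μ.restrict {p : ℝ × ℝ | p.1 = p.2}),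
      ∀ w ∈ msupport (μ.restrict {p : ℝ × ℝ | p.2 < p.1} +
        μ.restrict {p : ℝ × ℝ | p.1 = p.2}),
        0 ≤ (z.1 - w.1) * (z.2 - w.2)) ∧
    (∀ z ∈ msupport (μ.restrict {p : ℝ × ℝ | p.1 < p.2} +
        μ.restrict {p : ℝ × ℝ | p.1 = p.2}),
      ∀ w ∈ msupport (μ.restrict {p : ℝ × ℝ | p.1 < p.2} +
        μ.restrict {p : ℝ × ℝ | p.1 = p.2}),
        0 ≤ (z.1 - w.1) * (z.2 - w.2)) := by
  obtain ⟨hprob, hfst, hsnd⟩ := hμ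
  refine ⟨fun z hz w hw => ?_, fun z hz w hw => ?_⟩
  · have hzpos := measure_pos_of_mem_msupport_restrict_add hz
    have hwpos := measure_pos_of_mem_msupport_restrict_add hw
    by_contra! h
    rcases mul_neg_iff.1 h with ⟨h₁, h₂⟩ | ⟨h₁, h₂⟩
    · exact no_descent_of_snd_le_fst hfst hsnd havoid hwpos hzpos
        (snd_le_fst_of_mem_msupport hw) (by linarith) (by linarith)
    · exact no_descent_of_snd_le_fst hfst hsnd havoid hzpos hwpos
        (snd_le_fst_of_mem_msupport hz) (by linarith) (by linarith)
  · have hzpos := measure_pos_of_mem_msupport_restrict_add hz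
    have hwpos := measure_pos_of_mem_msupport_restrict_add hw
    by_contra! h
    rcases mul_neg_iff.1 h with ⟨h₁, h₂⟩ | ⟨h₁, h₂⟩
    · exact no_descent_of_fst_le_snd hfst hsnd havoid hwpos hzpos
        (fst_le_snd_of_mem_msupport hz) (by linarith) (by linarith)
    · exact no_descent_of_fst_le_snd hfst hsnd havoid hzpos hwpos
        (fst_le_snd_of_mem_msupport hw) (by linarith) (by linarith)

end
end

section
/- For every n ≥ 1, the map sending a 321-avoiding permutation σ of {1,…,n} to the pair (A,B), where A is the set of positions and B the set of values of its strict right-to-left minima, is a bijection from the set of 321-avoiding permutations of {1,…,n} onto Dyck_n. -/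
open MeasureTheory Filter Set

attribute [local instance] Classical.propDecidable

noncomputable section

/-- `σ` avoids the pattern `321`. -/
def Avoids321 {n : ℕ} (σ : Equiv.Perm (Fin n)) : Prop :=
  ¬ ∃ i j k : Fin n, i < j ∧ j < k ∧ σ j < σ i ∧ σ k < σ j

/-- `(a, σ a)` is a strict right-to-left minimum of `σ`:
`σ(a) < a` and `σ(c) > σ(a)` for all `c > a`. -/
def IsStrictRLMin {n : ℕ} (σ : Equiv.Perm (Fin n)) (a : Fin n) : Prop :=
  σ a < a ∧ ∀ c : Fin n, a < c → σ a < σ c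

/-- The set of positions of strict right-to-left minima of `σ`. -/
def RLMpositions {n : ℕ} (σ : Equiv.Perm (Fin n)) : Finset (Fin n) :=
  Finset.univ.filter (fun a => IsStrictRLMin σ a)

/-- `Dyck_n`: pairs `(A,B)` of subsets of `{1,…,n}` with `|A| = |B|` and `aᵢ > bᵢ` for
all `i`, where `aᵢ` (resp. `bᵢ`) is the `i`-th smallest element of `A` (resp. `B`). -/
def DyckSet (n : ℕ) : Set (Finset (Fin n) × Finset (Fin n)) :=
  {p | ∃ h : p.1.card = p.2.card,
    ∀ i : Fin p.1.card, p.2.orderEmbOfFin h.symm i < p.1.orderEmbOfFin rfl i}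

theorem Fin.le_of_injective_of_mapsTo_Iic {n : ℕ} {f : Fin n → Fin n} (hf : Function.Injective f)
    {a b : Fin n} (h : ∀ i ≤ a, f i ≤ b) : a ≤ b := by
  have hcard := Finset.card_le_card_of_injOn (s := Finset.Iic a) (t := Finset.Iic b) f
    (fun i hi => by simpa using h i (by simpa using hi)) hf.injOn
  simp only [Fin.card_Iic] at hcard
  exact Fin.le_def.2 (by omega)

theorem StrictMonoOn.apply_orderEmbOfFin {α β : Type*} [LinearOrder α] [LinearOrder β]
    {f : α → β} {A : Finset α} {B : Finset β} (hf : StrictMonoOn f A)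
    (hAB : ∀ x ∈ A, f x ∈ B) (h : B.card = A.card) (i : Fin A.card) :
    f (A.orderEmbOfFin rfl i) = B.orderEmbOfFin h i :=
  congrFun (Finset.orderEmbOfFin_unique (f := fun j => f (A.orderEmbOfFin rfl j)) h
    (fun j => hAB _ (A.orderEmbOfFin_mem rfl j))
    (fun j k hjk => hf (A.orderEmbOfFin_mem rfl j) (A.orderEmbOfFin_mem rfl k)
      ((A.orderEmbOfFin rfl).strictMono hjk))) i

theorem StrictMonoOn.eqOn_of_mapsTo_of_card_eq {α β : Type*} [LinearOrder α] [LinearOrder β]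
    {f g : α → β} {A : Finset α} {B : Finset β} (hf : StrictMonoOn f A) (hg : StrictMonoOn g A)
    (hfB : ∀ x ∈ A, f x ∈ B) (hgB : ∀ x ∈ A, g x ∈ B) (h : B.card = A.card) :
    ∀ x ∈ A, f x = g x := by
  intro x hx
  obtain ⟨i, rfl⟩ : x ∈ Set.range (A.orderEmbOfFin rfl) := by simpa using hx
  rw [hf.apply_orderEmbOfFin hfB h, hg.apply_orderEmbOfFin hgB h]

theorem Equiv.Perm.exists_strictMonoOn_strictMonoOn_compl {α : Type*} [LinearOrder α] [Fintype α]
    {A B : Finset α} (h : A.card = B.card) :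
    ∃ σ : Equiv.Perm α, (∀ x, σ x ∈ B ↔ x ∈ A) ∧ StrictMonoOn σ {x | x ∈ A} ∧
      StrictMonoOn σ {x | x ∉ A} := by
  have hc : Fintype.card {x // x ∉ B} = Fintype.card {x // x ∉ A} := by
    rw [Fintype.card_subtype_compl, Fintype.card_subtype_compl, Fintype.card_coe,
      Fintype.card_coe, h]
  let e : {x // x ∈ A} ≃o {x // x ∈ B} :=
    (A.orderIsoOfFin rfl).symm.trans (B.orderIsoOfFin h.symm)
  let f : {x // x ∉ A} ≃o {x // x ∉ B} :=
    (monoEquivOfFin {x // x ∉ A} rfl).symm.trans (monoEquivOfFin {x // x ∉ B} hc)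
  let σ : Equiv.Perm α := Equiv.subtypeCongr e.toEquiv f.toEquiv
  have hσe : ∀ x (hx : x ∈ A), σ x = e ⟨x, hx⟩ := fun x hx => by
    simp [σ, Equiv.subtypeCongr, Equiv.sumCompl_symm_apply_of_pos hx]
  have hσf : ∀ x (hx : x ∉ A), σ x = f ⟨x, hx⟩ := fun x hx => by
    simp [σ, Equiv.subtypeCongr, Equiv.sumCompl_symm_apply_of_neg hx]
  refine ⟨σ, fun x => ?_, fun x hx y hy hxy => ?_, fun x hx y hy hxy => ?_⟩
  · by_cases hx : x ∈ A
    · simp [hσe x hx, hx]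
    · simpa only [hσf x hx, hx, iff_false] using (f ⟨x, hx⟩).2
  · rw [hσe x hx, hσe y hy]
    exact e.strictMono hxy
  · rw [hσf x hx, hσf y hy]
    exact f.strictMono hxy

namespace Avoids321

variable {n : ℕ} {σ : Equiv.Perm (Fin n)}

theorem isStrictRLMin_iff (hσ : Avoids321 σ) (a : Fin n) : IsStrictRLMin σ a ↔ σ a < a := by
  refine ⟨And.left, fun ha => ⟨ha, fun c hac => ?_⟩⟩
  by_contra! hc
  obtain ⟨i, hia, hi⟩ : ∃ i ≤ a, σ a < σ i := by
    by_contra! h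
    exact ha.not_ge (Fin.le_of_injective_of_mapsTo_Iic σ.injective h)
  exact hσ ⟨i, a, c, hia.lt_of_ne (by rintro rfl; exact hi.false), hac, hi,
    hc.lt_of_ne (σ.injective.ne hac.ne')⟩

theorem mem_RLMpositions (hσ : Avoids321 σ) (a : Fin n) : a ∈ RLMpositions σ ↔ σ a < a := by
  simp [RLMpositions, hσ.isStrictRLMin_iff]

theorem strictMonoOn_of_le (hσ : Avoids321 σ) : StrictMonoOn σ {a | a ≤ σ a} := by
  intro i _ j hj hij
  by_contra! h
  have hji : σ j < σ i := h.lt_of_ne (σ.injective.ne hij.ne')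
  have hmaps : ∀ v ∈ Finset.Iic (σ j), σ.symm v ∈ (Finset.Iic j).erase i := by
    intro v hv
    rw [Finset.mem_Iic] at hv
    refine Finset.mem_erase.2 ⟨?_, Finset.mem_Iic.2 ?_⟩
    · rintro rfl
      simp only [Equiv.apply_symm_apply] at hji
      exact hji.not_ge hv
    · by_contra! hk
      refine hσ ⟨i, j, σ.symm v, hij, hk, hji, ?_⟩
      rw [Equiv.apply_symm_apply]
      refine hv.lt_of_ne ?_
      rintro rfl
      simp at hk
  have hcard := Finset.card_le_card_of_injOn σ.symm hmaps σ.symm.injective.injOn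
  rw [Finset.card_erase_of_mem (Finset.mem_Iic.2 hij.le), Fin.card_Iic, Fin.card_Iic] at hcard
  have hj' : (j : ℕ) ≤ σ j := hj
  omega

end Avoids321

theorem strictMonoOn_RLMpositions {n : ℕ} (σ : Equiv.Perm (Fin n)) :
    StrictMonoOn σ (RLMpositions σ) := by
  intro i hi j _ hij
  simp only [RLMpositions, Finset.coe_filter, Finset.mem_univ, true_and] at hi
  exact hi.2 j hij

theorem pair_RLMpositions_mem_DyckSet {n : ℕ} (σ : Equiv.Perm (Fin n)) :
    (RLMpositions σ, (RLMpositions σ).image σ) ∈ DyckSet n := by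
  have h : ((RLMpositions σ).image σ).card = (RLMpositions σ).card :=
    Finset.card_image_of_injective _ σ.injective
  refine ⟨h.symm, fun i => ?_⟩
  have hi := (RLMpositions σ).orderEmbOfFin_mem rfl i
  rw [← (strictMonoOn_RLMpositions σ).apply_orderEmbOfFin
    (fun x hx => Finset.mem_image_of_mem σ hx) h i]
  simp only [RLMpositions, Finset.mem_filter] at hi
  exact hi.2.1

theorem injOn_pair_RLMpositions (n : ℕ) :
    Set.InjOn
      (fun σ : Equiv.Perm (Fin n) => (RLMpositions σ, (RLMpositions σ).image σ))
      {σ : Equiv.Perm (Fin n) | Avoids321 σ} := by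
  intro σ hσ τ hτ hστ
  obtain ⟨hA, hB⟩ := Prod.mk.inj hστ
  have hτA : StrictMonoOn τ (RLMpositions σ) := hA ▸ strictMonoOn_RLMpositions τ
  have hcard : ((RLMpositions σ).image σ).card = (RLMpositions σ).card :=
    Finset.card_image_of_injective _ σ.injective
  have hcompl : ∀ {ρ : Equiv.Perm (Fin n)}, Avoids321 ρ → RLMpositions ρ = RLMpositions σ →
      StrictMonoOn ρ (Finset.univ.filter (· ∉ RLMpositions σ) : Finset (Fin n)) := by
    intro ρ hρ h
    refine hρ.strictMonoOn_of_le.mono fun x hx => ?_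
    simpa [← h, hρ.mem_RLMpositions] using hx
  ext1 x
  by_cases hx : x ∈ RLMpositions σ
  · refine (strictMonoOn_RLMpositions σ).eqOn_of_mapsTo_of_card_eq hτA
      (B := (RLMpositions σ).image σ) (fun y hy => Finset.mem_image_of_mem σ hy)
      (fun y hy => ?_) hcard x hx
    rw [hB]
    exact Finset.mem_image_of_mem τ (hA ▸ hy)
  · refine (hcompl hσ rfl).eqOn_of_mapsTo_of_card_eq (hcompl hτ hA.symm)
      (B := (Finset.univ.filter (· ∉ RLMpositions σ)).image σ)
      (fun y hy => Finset.mem_image_of_mem σ hy) (fun y hy => ?_)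
      (Finset.card_image_of_injective _ σ.injective) x (by simpa using hx)
    refine Finset.mem_image.2 ⟨σ.symm (τ y), ?_, by simp⟩
    have hy' : y ∉ RLMpositions τ := by simpa [← hA] using hy
    have hτy : τ y ∉ (RLMpositions σ).image σ := by
      rw [hB]
      simpa using hy'
    simp only [Finset.mem_filter, Finset.mem_univ, true_and]
    exact fun h => hτy (Finset.mem_image.2 ⟨_, h, by simp⟩)

theorem avoids321_of_strictMonoOn {n : ℕ} {σ : Equiv.Perm (Fin n)} {A : Finset (Fin n)}
    (h : StrictMonoOn σ {x | x ∈ A}) (h' : StrictMonoOn σ {x | x ∉ A}) : Avoids321 σ := by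
  rintro ⟨i, j, k, hij, hjk, hji, hkj⟩
  have key : ∀ {x y}, x < y → σ y < σ x → (x ∈ A ↔ y ∉ A) := by
    intro x y hxy hyx
    by_cases hx : x ∈ A <;> by_cases hy : y ∈ A
    · exact absurd (h hx hy hxy) hyx.not_gt
    · simp [hx, hy]
    · simp [hx, hy]
    · exact absurd (h' hx hy hxy) hyx.not_gt
  have h₁ := key hij hji
  have h₂ := key hjk hkj
  have h₃ := key (hij.trans hjk) (hkj.trans hji)
  tauto

theorem le_apply_of_strictMonoOn_compl {n : ℕ} {σ : Equiv.Perm (Fin n)} {A : Finset (Fin n)}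
    (hA : ∀ x ∈ A, σ x < x) (hσ : StrictMonoOn σ {x | x ∉ A}) {c : Fin n} (hc : c ∉ A) :
    c ≤ σ c := by
  by_contra! hlt
  have hmaps : ∀ x ∈ Finset.Iic c, σ x ∈ Finset.Iio c := by
    intro x hx
    rw [Finset.mem_Iic] at hx
    rw [Finset.mem_Iio]
    by_cases hxA : x ∈ A
    · exact (hA x hxA).trans_le hx
    · exact (hσ.monotoneOn hxA hc hx).trans_lt hlt
  have hcard := Finset.card_le_card_of_injOn σ hmaps σ.injective.injOn
  simp at hcard

theorem surjOn_pair_RLMpositions (n : ℕ) :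
    Set.SurjOn
      (fun σ : Equiv.Perm (Fin n) => (RLMpositions σ, (RLMpositions σ).image σ))
      {σ : Equiv.Perm (Fin n) | Avoids321 σ} (DyckSet n) := by
  rintro ⟨A, B⟩ ⟨hcard, hlt⟩
  dsimp only at hcard hlt
  obtain ⟨σ, hAB, hmono, hmono'⟩ := Equiv.Perm.exists_strictMonoOn_strictMonoOn_compl hcard
  have hA : ∀ x ∈ A, σ x < x := by
    intro x hx
    obtain ⟨i, rfl⟩ : x ∈ Set.range (A.orderEmbOfFin rfl) := by simpa using hx
    rw [StrictMonoOn.apply_orderEmbOfFin hmono (fun x hx => (hAB x).2 hx) hcard.symm]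
    exact hlt i
  have hσ : Avoids321 σ := avoids321_of_strictMonoOn hmono hmono'
  have hpos : RLMpositions σ = A := by
    ext x
    rw [hσ.mem_RLMpositions]
    refine ⟨fun hx => ?_, hA x⟩
    by_contra hxA
    exact hx.not_ge (le_apply_of_strictMonoOn_compl hA hmono' hxA)
  refine ⟨σ, hσ, Prod.ext hpos ?_⟩
  ext y
  simp only [hpos, Finset.mem_image]
  refine ⟨?_, fun hy => ⟨σ.symm y, (hAB _).1 (by simpa using hy), by simp⟩⟩
  rintro ⟨x, hx, rfl⟩
  exact (hAB x).2 hx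

/-- The map sending a `321`-avoiding permutation to the pair (positions, values) of its
strict right-to-left minima is a bijection onto `Dyck_n`. -/
theorem bijection_321_avoiding_Dyck (n : ℕ) (hn : 1 ≤ n) :
    Set.BijOn
      (fun σ : Equiv.Perm (Fin n) => (RLMpositions σ, (RLMpositions σ).image σ))
      {σ : Equiv.Perm (Fin n) | Avoids321 σ} (DyckSet n) :=
  ⟨fun σ _ => pair_RLMpositions_mem_DyckSet σ, injOn_pair_RLMpositions n,
    surjOn_pair_RLMpositions n⟩

end
end

section
/- Let σ be a 321-avoiding permutation of {1,…,n} with strict right-to-left minima ((a₁,b₁),…,(a_k,b_k)) listed in increasing order, and let ρ₁^σ, ρ₂^σ be the Lebesgue densities of π₁^σ and π₂^σ. Then inv(σ) = Σ_{i=1}^{k} (a_i − b_i) = n² · ∫₀¹ x·(ρ₁^σ(x) − ρ₂^σ(x)) dx. -/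
open MeasureTheory Filter Set

attribute [local instance] Classical.propDecidable

noncomputable section

/-- Number of inversions of a permutation of `Fin n`. -/
def invCount {n : ℕ} (σ : Equiv.Perm (Fin n)) : ℕ :=
  (Finset.univ.filter (fun p : Fin n × Fin n => p.1 < p.2 ∧ σ p.2 < σ p.1)).card

/-- The measure `π₁^σ`: sum of Lebesgue measure restricted to the intervals
`[(a_j−1)/n, a_j/n]` over positions `a_j` of strict right-to-left minima
(`a_j = a + 1` for the 0-indexed position `a`). -/
def pi1 {n : ℕ} (σ : Equiv.Perm (Fin n)) : Measure ℝ :=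
  ∑ a ∈ RLMpositions σ,
    volume.restrict (Set.Icc (((a : ℕ) : ℝ) / n) ((((a : ℕ) : ℝ) + 1) / n))

/-- The measure `π₂^σ`: likewise for the values `b_j` of strict right-to-left minima. -/
def pi2 {n : ℕ} (σ : Equiv.Perm (Fin n)) : Measure ℝ :=
  ∑ a ∈ RLMpositions σ,
    volume.restrict (Set.Icc ((((σ a : Fin n) : ℕ) : ℝ) / n) (((((σ a : Fin n) : ℕ) : ℝ) + 1) / n))

/-- If the value of `σ` at `j` lies below all later values, then exactly `j - σ j` earlier
positions carry a larger value. -/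
lemma card_inversions_ending_at {n : ℕ} (σ : Equiv.Perm (Fin n)) (j : Fin n)
    (hj : ∀ c : Fin n, j < c → σ j < σ c) :
    (Finset.univ.filter (fun i : Fin n => i < j ∧ σ j < σ i)).card + (σ j : ℕ) = j := by
  have hsmall : (Finset.univ.filter (fun i : Fin n => σ i < σ j)).card = (σ j : ℕ) := by
    rw [← Fin.card_Iio (σ j), ← Finset.card_map σ.toEmbedding]
    congr 1
    ext i
    simp [Finset.mem_map_equiv]
  have hearlier : (Finset.univ.filter (fun i : Fin n => i < j)).card = (j : ℕ) := by
    rw [← Fin.card_Iio j]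
    congr 1
    ext i
    simp
  rw [← hearlier, ← hsmall, ← Finset.card_union_of_disjoint]
  · congr 1
    ext i
    simp only [Finset.mem_union, Finset.mem_filter, Finset.mem_univ, true_and]
    constructor
    · rintro (h | h)
      · exact h.1
      · by_contra hij
        rcases (not_lt.mp hij).eq_or_lt with rfl | hlt
        · exact lt_irrefl _ h
        · exact lt_asymm h (hj i hlt)
    · intro h
      rcases lt_trichotomy (σ i) (σ j) with h' | h' | h'
      · exact Or.inr h'
      · exact absurd (σ.injective h') h.ne
      · exact Or.inl ⟨h, h'⟩
  · rw [Finset.disjoint_left]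
    intro i hi hi'
    simp only [Finset.mem_filter, Finset.mem_univ, true_and] at hi hi'
    exact lt_asymm hi.2 hi'

/-- In a `321`-avoiding permutation, every inversion ends at a strict right-to-left minimum. -/
lemma Avoids321.isStrictRLMin_of_inversion {n : ℕ} {σ : Equiv.Perm (Fin n)} (h : Avoids321 σ)
    {i j : Fin n} (hij : i < j) (hσ : σ j < σ i) : IsStrictRLMin σ j := by
  have hlater : ∀ c : Fin n, j < c → σ j < σ c := by
    intro c hc
    by_contra hcj
    rcases (not_lt.mp hcj).eq_or_lt with heq | hlt
    · exact hc.ne' (σ.injective heq)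
    · exact h ⟨i, j, c, hij, hc, hσ, hlt⟩
  refine ⟨?_, hlater⟩
  have hcard := card_inversions_ending_at σ j hlater
  have hpos : 0 < (Finset.univ.filter (fun i : Fin n => i < j ∧ σ j < σ i)).card :=
    Finset.card_pos.mpr ⟨i, by simp [hij, hσ]⟩
  rw [Fin.lt_def]
  omega

lemma Avoids321.invCount_eq {n : ℕ} {σ : Equiv.Perm (Fin n)} (h : Avoids321 σ) :
    invCount σ = ∑ a ∈ RLMpositions σ, ((a : ℕ) - ((σ a : Fin n) : ℕ)) := by
  unfold invCount
  rw [Finset.card_eq_sum_card_fiberwise (f := Prod.snd) (t := RLMpositions σ)]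
  · refine Finset.sum_congr rfl fun j hj => ?_
    have hj' : IsStrictRLMin σ j := by simpa [RLMpositions] using hj
    rw [← Nat.eq_sub_of_add_eq (card_inversions_ending_at σ j hj'.2)]
    refine Finset.card_bij' (fun p _ => p.1) (fun i _ => (i, j)) ?_ ?_ ?_ ?_
    · rintro ⟨a, b⟩ hp
      simp only [Finset.mem_filter, Finset.mem_univ, true_and] at hp ⊢
      obtain ⟨hp, rfl⟩ := hp
      exact hp
    · intro a ha
      simpa using ha
    · rintro ⟨a, b⟩ hp
      simp only [Finset.mem_filter, Finset.mem_univ, true_and] at hp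
      rw [hp.2]
    · intro a _
      rfl
  · rintro ⟨i, j⟩ hp
    have hp' : i < j ∧ σ j < σ i := by simpa using hp
    simpa [RLMpositions] using h.isStrictRLMin_of_inversion hp'.1 hp'.2

/-- The first moment of a density of a finite sum of Lebesgue measures on subintervals of
`[0, 1]`. -/
lemma first_moment_of_density {ι : Type*} (s : Finset ι) (u v : ι → ℝ)
    (hu : ∀ i ∈ s, 0 ≤ u i) (huv : ∀ i ∈ s, u i ≤ v i) (hv : ∀ i ∈ s, v i ≤ 1)
    (ρ : ℝ → ℝ) (hρm : Measurable ρ) (hρ0 : ∀ x, 0 ≤ ρ x)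
    (hρ : ∑ i ∈ s, volume.restrict (Icc (u i) (v i))
      = volume.withDensity (fun x => ENNReal.ofReal (ρ x))) :
    IntervalIntegrable (fun x => x * ρ x) volume 0 1 ∧
      ∫ x in (0:ℝ)..1, x * ρ x = ∑ i ∈ s, (v i ^ 2 - u i ^ 2) / 2 := by
  have hint : ∀ i ∈ s, Integrable (fun x : ℝ => x) (volume.restrict (Icc (u i) (v i))) :=
    fun i _ => continuous_id.integrableOn_Icc
  have hmul : (fun x => (ENNReal.ofReal (ρ x)).toReal • x) = fun x => x * ρ x := by
    funext x
    rw [ENNReal.toReal_ofReal (hρ0 x), smul_eq_mul, mul_comm]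
  have hdens : Measurable fun x => ENNReal.ofReal (ρ x) := hρm.ennreal_ofReal
  have hInt : Integrable (fun x => x * ρ x) volume := by
    rw [← hmul, ← integrable_withDensity_iff_integrable_smul' hdens (by simp), ← hρ]
    exact integrable_finsetSum_measure.mpr hint
  refine ⟨hInt.intervalIntegrable, ?_⟩
  have hmem : ∀ᵐ x ∂(volume.withDensity fun x => ENNReal.ofReal (ρ x)),
      x ∈ Icc (0 : ℝ) 1 := by
    rw [← hρ, ae_finsetSum_measure_iff]
    intro i hi
    filter_upwards [ae_restrict_mem measurableSet_Icc] with x hx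
    exact ⟨(hu i hi).trans hx.1, hx.2.trans (hv i hi)⟩
  rw [intervalIntegral.integral_of_le zero_le_one, ← integral_Icc_eq_integral_Ioc, ← hmul,
    ← setIntegral_withDensity_eq_setIntegral_toReal_smul hdens (by simp) _ measurableSet_Icc,
    Measure.restrict_eq_self_of_ae_mem hmem, ← hρ, integral_finsetSum_measure hint]
  refine Finset.sum_congr rfl fun i hi => ?_
  rw [integral_Icc_eq_integral_Ioc, ← intervalIntegral.integral_of_le (huv i hi), integral_id]

/-- The case of `first_moment_of_density` where the subintervals are cells of the uniform
subdivision of `[0, 1]` into `n` pieces. -/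
lemma first_moment_of_density_cells {n : ℕ} (hn : 1 ≤ n) {ι : Type*} (s : Finset ι)
    (f : ι → Fin n) (ρ : ℝ → ℝ) (hρm : Measurable ρ) (hρ0 : ∀ x, 0 ≤ ρ x)
    (hρ : ∑ i ∈ s, volume.restrict (Icc (((f i : ℕ) : ℝ) / n) ((((f i : ℕ) : ℝ) + 1) / n))
      = volume.withDensity (fun x => ENNReal.ofReal (ρ x))) :
    IntervalIntegrable (fun x => x * ρ x) volume 0 1 ∧
      (n : ℝ) ^ 2 * ∫ x in (0:ℝ)..1, x * ρ x = ∑ i ∈ s, (((f i : ℕ) : ℝ) + 1 / 2) := by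
  have hn0 : (0 : ℝ) < n := by exact_mod_cast hn
  obtain ⟨hInt, heq⟩ := first_moment_of_density s _ _ (fun i _ => by positivity)
    (fun i _ => by gcongr; linarith)
    (fun i _ => by rw [div_le_one hn0]; exact_mod_cast (f i).isLt) ρ hρm hρ0 hρ
  refine ⟨hInt, ?_⟩
  rw [heq, Finset.mul_sum]
  refine Finset.sum_congr rfl fun i _ => ?_
  field_simp
  ring

/-- For a `321`-avoiding permutation,
`inv(σ) = Σᵢ (aᵢ − bᵢ) = n² ∫₀¹ x (ρ₁^σ(x) − ρ₂^σ(x)) dx`, where `ρ₁^σ, ρ₂^σ` are the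
Lebesgue densities of `π₁^σ, π₂^σ`. -/
theorem inversions_321_avoiding (n : ℕ) (hn : 1 ≤ n) (σ : Equiv.Perm (Fin n))
    (havoid : Avoids321 σ)
    (ρ₁ ρ₂ : ℝ → ℝ) (hρ₁m : Measurable ρ₁) (hρ₂m : Measurable ρ₂)
    (hρ₁0 : ∀ x, 0 ≤ ρ₁ x) (hρ₂0 : ∀ x, 0 ≤ ρ₂ x)
    (hρ₁ : pi1 σ = volume.withDensity (fun x => ENNReal.ofReal (ρ₁ x)))
    (hρ₂ : pi2 σ = volume.withDensity (fun x => ENNReal.ofReal (ρ₂ x))) :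
    invCount σ = ∑ a ∈ RLMpositions σ, ((a : ℕ) - ((σ a : Fin n) : ℕ)) ∧
    (invCount σ : ℝ) = n ^ 2 * ∫ x in (0:ℝ)..1, x * (ρ₁ x - ρ₂ x) := by
  refine ⟨havoid.invCount_eq, ?_⟩
  obtain ⟨hInt₁, heq₁⟩ := first_moment_of_density_cells hn (RLMpositions σ) id ρ₁ hρ₁m hρ₁0 hρ₁
  obtain ⟨hInt₂, heq₂⟩ := first_moment_of_density_cells hn (RLMpositions σ) σ ρ₂ hρ₂m hρ₂0 hρ₂
  simp_rw [mul_sub]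
  rw [intervalIntegral.integral_sub hInt₁ hInt₂, mul_sub, heq₁, heq₂, ← Finset.sum_sub_distrib,
    havoid.invCount_eq, Nat.cast_sum]
  refine Finset.sum_congr rfl fun a ha => ?_
  have ha' : IsStrictRLMin σ a := by simpa [RLMpositions] using ha
  rw [Nat.cast_sub (Fin.le_def.mp ha'.1.le), id]
  ring

end
end

section
/- Let σ be a 231-avoiding permutation of {1,…,n}. Then inv(σ) = C(n,2) − Σ_{x=0}^{n−1} F_σ(x), where C(n,2) = n(n−1)/2. -/
open MeasureTheory Filter Set

attribute [local instance] Classical.propDecidable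

noncomputable section

/-- `σ` avoids the pattern `231`. -/
def Avoids231 {n : ℕ} (σ : Equiv.Perm (Fin n)) : Prop :=
  ¬ ∃ i j k : Fin n, i < j ∧ j < k ∧ σ k < σ i ∧ σ i < σ j

/-- The value `F_σ(x) = min{σ(c) : c > x} − 1` at an integer `x ∈ {0,…,n−1}`, for the
1-indexed version of `σ`; for the 0-indexed `σ : Equiv.Perm (Fin n)` this equals
`min{σ(c) : c ≥ x}`. -/
def Fcurve {n : ℕ} (σ : Equiv.Perm (Fin n)) (x : ℕ) : ℕ :=
  sInf {m : ℕ | ∃ c : Fin n, x ≤ (c : ℕ) ∧ ((σ c : Fin n) : ℕ) = m}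

/-- The value `F_σ(i)` is the smallest value of `σ` at positions `≥ i`. -/
theorem exists_Fcurve_eq {n : ℕ} (σ : Equiv.Perm (Fin n)) (i : Fin n) :
    ∃ c : Fin n, i ≤ c ∧ (σ c : ℕ) = Fcurve σ i ∧ ∀ d : Fin n, i ≤ d → σ c ≤ σ d := by
  have hne : {m : ℕ | ∃ c : Fin n, (i : ℕ) ≤ c ∧ (σ c : ℕ) = m}.Nonempty :=
    ⟨_, i, le_rfl, rfl⟩
  obtain ⟨c, hc, h⟩ := Nat.sInf_mem hne
  refine ⟨c, hc, h, fun d hd => ?_⟩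
  rw [Fin.le_def, h]
  exact Nat.sInf_le ⟨d, hd, rfl⟩

/-- In a `231`-avoiding permutation, `F_σ(i)` counts the noninversions ending at `i`. -/
theorem card_noninversions_eq_Fcurve {n : ℕ} (σ : Equiv.Perm (Fin n)) (havoid : Avoids231 σ)
    (i : Fin n) :
    (Finset.univ.filter (fun j : Fin n => j < i ∧ σ j < σ i)).card = Fcurve σ i := by
  obtain ⟨c, hic, hc, hmin⟩ := exists_Fcurve_eq σ i
  rw [← hc, ← Fin.card_Iio (σ c)]
  refine Finset.card_bij (fun j _ => σ j) ?_ (fun _ _ _ _ h => σ.injective h) ?_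
  · intro j hj
    obtain ⟨hji, hlt⟩ := (Finset.mem_filter.mp hj).2
    rw [Finset.mem_Iio]
    by_contra! hle
    have hcj : σ c < σ j := lt_of_le_of_ne hle fun h =>
      (hji.trans_le hic).ne (σ.injective h).symm
    refine havoid ⟨j, i, c, hji, lt_of_le_of_ne hic ?_, hcj, hlt⟩
    rintro rfl
    exact lt_asymm hcj hlt
  · intro v hv
    rw [Finset.mem_Iio] at hv
    refine ⟨σ.symm v, ?_, σ.apply_symm_apply v⟩
    simp only [Finset.mem_filter, Finset.mem_univ, true_and, Equiv.apply_symm_apply]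
    refine ⟨?_, hv.trans_le (hmin i le_rfl)⟩
    by_contra! h
    have := hmin _ h
    rw [Equiv.apply_symm_apply] at this
    exact absurd hv this.not_gt

/-- Grouping the inversions by their right endpoint. -/
theorem invCount_eq_sum {n : ℕ} (σ : Equiv.Perm (Fin n)) :
    invCount σ =
      ∑ i : Fin n, (Finset.univ.filter (fun j : Fin n => j < i ∧ σ i < σ j)).card := by
  simp only [invCount, Finset.card_filter]
  rw [Fintype.sum_prod_type_right]

/-- Every position before `i` forms either an inversion or a noninversion with `i`. -/
theorem card_inversions_add_card_noninversions {n : ℕ} (σ : Equiv.Perm (Fin n)) (i : Fin n) :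
    (Finset.univ.filter (fun j : Fin n => j < i ∧ σ i < σ j)).card +
      (Finset.univ.filter (fun j : Fin n => j < i ∧ σ j < σ i)).card = i := by
  rw [← Fin.card_Iio i, ← Finset.card_union_of_disjoint]
  · congr 1
    ext j
    simp only [Finset.mem_union, Finset.mem_filter, Finset.mem_univ, true_and, Finset.mem_Iio,
      ← and_or_left, and_iff_left_iff_imp]
    exact fun h => lt_or_gt_of_ne fun e => h.ne (σ.injective e).symm
  · rw [Finset.disjoint_filter]
    exact fun _ _ h h' => lt_asymm h.2 h'.2

/-- For a `231`-avoiding permutation, `inv(σ) = C(n,2) − Σ_{x=0}^{n−1} F_σ(x)`. -/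
theorem inversions_231_avoiding (n : ℕ) (hn : 1 ≤ n) (σ : Equiv.Perm (Fin n))
    (havoid : Avoids231 σ) :
    (invCount σ : ℤ) = (n.choose 2 : ℤ) - ∑ x ∈ Finset.range n, (Fcurve σ x : ℤ) := by
  have key : invCount σ + ∑ x ∈ Finset.range n, Fcurve σ x = n.choose 2 := by
    rw [invCount_eq_sum, ← Fin.sum_univ_eq_sum_range, ← Finset.sum_add_distrib,
      Nat.choose_two_right, ← Finset.sum_range_id, ← Fin.sum_univ_eq_sum_range (fun i => i)]
    refine Finset.sum_congr rfl fun i _ => ?_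
    rw [← card_noninversions_eq_Fcurve σ havoid, card_inversions_add_card_noninversions]
  rw [← key]
  push_cast
  ring

end
end
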